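/- Let f_t = P_t f for a measurable f: R^n → [0,1], let k_t = e^{-t}/sqrt(1 - e^{-2t}), and suppose M is a median of f_t with respect to γ_n. Then E[f_t] ≤ 2 · M^{(1/(1+k_t))^2}. -/

import Mathlib

open MeasureTheory Real Filter
open scoped ENNReal NNReal

noncomputable def stdGaussian (n : ℕ) : Measure (Fin n → ℝ) :=
  Measure.pi fun _ => ProbabilityTheory.gaussianReal 0 1

noncomputable def gaussPhi (x : ℝ) : ℝ := (Real.sqrt (2 * Real.pi))⁻¹ * Real.exp (-(x ^ 2) / 2)

noncomputable def gaussCdf (x : ℝ) : ℝ := ∫ y in Set.Iic x, gaussPhi y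

noncomputable def gaussCdfInv : ℝ → ℝ := Function.invFun gaussCdf

/-- The Gaussian isoperimetric function `I = φ ∘ Φ⁻¹`, extended by `I(0) = I(1) = 0`. -/
noncomputable def isoI (a : ℝ) : ℝ := if a ≤ 0 ∨ 1 ≤ a then 0 else gaussPhi (gaussCdfInv a)

/-- Ornstein-Uhlenbeck semigroup. -/
noncomputable def OU (n : ℕ) (t : ℝ) (f : (Fin n → ℝ) → ℝ) (x : Fin n → ℝ) : ℝ :=
  ∫ y, f (fun i => Real.exp (-t) * x i + Real.sqrt (1 - Real.exp (-2 * t)) * y i) ∂(stdGaussian n)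

/-- Partial derivative in direction `i`. -/
noncomputable def pd {n : ℕ} (i : Fin n) (f : (Fin n → ℝ) → ℝ) (x : Fin n → ℝ) : ℝ :=
  fderiv ℝ f x (Pi.single i 1)

/-- Second partial derivative. -/
noncomputable def pd2 {n : ℕ} (i j : Fin n) (f : (Fin n → ℝ) → ℝ) (x : Fin n → ℝ) : ℝ :=
  pd j (pd i f) x

/-- Euclidean norm of the gradient. -/
noncomputable def gradNorm {n : ℕ} (f : (Fin n → ℝ) → ℝ) (x : Fin n → ℝ) : ℝ :=
  Real.sqrt (∑ i, (pd i f x) ^ 2)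

/-- Frobenius norm of the Hessian. -/
noncomputable def hessFrob {n : ℕ} (f : (Fin n → ℝ) → ℝ) (x : Fin n → ℝ) : ℝ :=
  Real.sqrt (∑ i, ∑ j, (pd2 i j f x) ^ 2)

noncomputable def frob {n : ℕ} (A : Matrix (Fin n) (Fin n) ℝ) : ℝ :=
  Real.sqrt (∑ i, ∑ j, (A i j) ^ 2)

/-- One-dimensional Hermite polynomial (physicists'/probabilists' unnormalized, as in the paper). -/
noncomputable def hermite1 (k : ℕ) (x : ℝ) : ℝ :=
  Real.exp (x ^ 2 / 2) * iteratedDeriv k (fun y => Real.exp (-(y ^ 2) / 2)) x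

/-- Multi-dimensional Hermite polynomial. -/
noncomputable def hermiteM {n : ℕ} (α : Fin n → ℕ) (x : Fin n → ℝ) : ℝ :=
  ∏ i, hermite1 (α i) (x i)

/-- Orthonormal Hermite polynomial. -/
noncomputable def hermiteG {n : ℕ} (α : Fin n → ℕ) (x : Fin n → ℝ) : ℝ :=
  hermiteM α x / Real.sqrt (∏ i, Nat.factorial (α i))

/-- `M` is a median of `f` under `μ`. -/
def IsMedian {Ω : Type*} [MeasurableSpace Ω] (μ : Measure Ω) (f : Ω → ℝ) (M : ℝ) : Prop :=
  (1 : ℝ≥0∞) / 2 ≤ μ {x | f x ≤ M} ∧ (1 : ℝ≥0∞) / 2 ≤ μ {x | M ≤ f x}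

/-- Gaussian boundary measure (perimeter), via smooth vector fields all of whose
derivatives vanish at infinity. -/
noncomputable def gaussBoundary (n : ℕ) (A : Set (Fin n → ℝ)) : ℝ :=
  sSup { r : ℝ | ∃ v : (Fin n → ℝ) → (Fin n → ℝ),
    ContDiff ℝ (⊤ : ℕ∞) v ∧
    (∀ k : ℕ, Tendsto (fun x => ‖iteratedFDeriv ℝ k v x‖) (cocompact _) (nhds 0)) ∧
    (∀ x, Real.sqrt (∑ i, (v x i) ^ 2) ≤ 1) ∧
    r = ∫ x in A, (∑ i, (pd i (fun y => v y i) x - x i * v x i)) ∂(stdGaussian n) }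

section

open ProbabilityTheory hiding stdGaussian
open Set Topology

lemma gaussPhi_eq_gaussianPDFReal (x : ℝ) : gaussPhi x = gaussianPDFReal 0 1 x := by
  simp [gaussPhi, gaussianPDFReal]

lemma gaussPhi_pos (x : ℝ) : 0 < gaussPhi x := by
  unfold gaussPhi; positivity

lemma gaussPhi_neg (x : ℝ) : gaussPhi (-x) = gaussPhi x := by
  simp [gaussPhi]

lemma gaussPhi_le_one (x : ℝ) : gaussPhi x ≤ 1 := by
  have h1 : 1 ≤ √(2 * π) := by
    rw [Real.one_le_sqrt]; linarith [Real.pi_gt_three]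
  have h2 : Real.exp (-(x ^ 2) / 2) ≤ 1 := by
    rw [Real.exp_le_one_iff]; nlinarith [sq_nonneg x]
  unfold gaussPhi
  exact mul_le_one₀ (inv_le_one_of_one_le₀ h1) (by positivity) h2

lemma hasDerivAt_gaussPhi (x : ℝ) : HasDerivAt gaussPhi (-x * gaussPhi x) x := by
  have h : HasDerivAt (fun y : ℝ => -(y ^ 2) / 2) (-x) x := by
    have := ((hasDerivAt_pow 2 x).neg).div_const 2
    convert! this using 1
    simp; ring
  have := h.exp.const_mul (√(2 * π))⁻¹
  convert! this using 1
  unfold gaussPhi; ring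

lemma continuous_gaussPhi : Continuous gaussPhi :=
  continuous_iff_continuousAt.2 fun x => (hasDerivAt_gaussPhi x).continuousAt

lemma integrable_gaussPhi : Integrable gaussPhi := by
  rw [show gaussPhi = gaussianPDFReal 0 1 from funext gaussPhi_eq_gaussianPDFReal]
  exact integrable_gaussianPDFReal 0 1

lemma gaussCdf_eq_real (x : ℝ) : gaussCdf x = (gaussianReal 0 1).real (Iic x) := by
  rw [measureReal_def, gaussianReal_apply_eq_integral 0 one_ne_zero, ENNReal.toReal_ofReal]
  · simp [gaussCdf, gaussPhi_eq_gaussianPDFReal]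
  · exact integral_nonneg fun y => gaussianPDFReal_nonneg 0 1 y

lemma hasDerivAt_gaussCdf (x : ℝ) : HasDerivAt gaussCdf (gaussPhi x) x := by
  have h : gaussCdf = fun y => gaussCdf 0 + ∫ u in (0 : ℝ)..y, gaussPhi u := by
    funext y
    have := intervalIntegral.integral_Iic_sub_Iic (μ := volume) (f := gaussPhi) (a := 0) (b := y)
      integrable_gaussPhi.integrableOn integrable_gaussPhi.integrableOn
    unfold gaussCdf
    linarith
  rw [h]
  exact (intervalIntegral.integral_hasDerivAt_right
    (continuous_gaussPhi.intervalIntegrable _ _)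
    (continuous_gaussPhi.stronglyMeasurableAtFilter _ _) continuous_gaussPhi.continuousAt).const_add _

lemma continuous_gaussCdf : Continuous gaussCdf :=
  continuous_iff_continuousAt.2 fun x => (hasDerivAt_gaussCdf x).continuousAt

lemma strictMono_gaussCdf : StrictMono gaussCdf :=
  strictMono_of_hasDerivAt_pos hasDerivAt_gaussCdf gaussPhi_pos

lemma tendsto_gaussCdf_atBot : Tendsto gaussCdf atBot (𝓝 0) := by
  have h : gaussCdf = cdf (gaussianReal 0 1) := by
    funext x; rw [gaussCdf_eq_real, cdf_eq_real]
  rw [h]; exact tendsto_cdf_atBot _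

lemma tendsto_gaussCdf_atTop : Tendsto gaussCdf atTop (𝓝 1) := by
  have h : gaussCdf = cdf (gaussianReal 0 1) := by
    funext x; rw [gaussCdf_eq_real, cdf_eq_real]
  rw [h]; exact tendsto_cdf_atTop _

lemma gaussCdf_mem_Ioo (x : ℝ) : gaussCdf x ∈ Ioo (0 : ℝ) 1 := by
  constructor
  · have h1 : 0 ≤ gaussCdf (x - 1) := by rw [gaussCdf_eq_real]; exact measureReal_nonneg
    exact h1.trans_lt (strictMono_gaussCdf (by linarith))
  · have h1 : gaussCdf (x + 1) ≤ 1 := by rw [gaussCdf_eq_real]; exact measureReal_le_one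
    exact (strictMono_gaussCdf (by linarith)).trans_le h1

lemma gaussCdf_neg (x : ℝ) : gaussCdf (-x) = 1 - gaussCdf x := by
  have hd : ∀ y, HasDerivAt (fun y => gaussCdf (-y) + gaussCdf y) 0 y := fun y => by
    have h := ((hasDerivAt_gaussCdf (-y)).comp y (hasDerivAt_neg y)).add (hasDerivAt_gaussCdf y)
    convert! h using 1
    rw [gaussPhi_neg]; ring
  have hc : ∀ y, gaussCdf (-y) + gaussCdf y = gaussCdf (-x) + gaussCdf x := fun y =>
    is_const_of_deriv_eq_zero (fun z => (hd z).differentiableAt) (fun z => (hd z).deriv) y x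
  have ht : Tendsto (fun y => gaussCdf (-y) + gaussCdf y) atTop (𝓝 (0 + 1)) :=
    (tendsto_gaussCdf_atBot.comp tendsto_neg_atTop_atBot).add tendsto_gaussCdf_atTop
  simp only [hc] at ht
  linarith [tendsto_nhds_unique ht tendsto_const_nhds]

lemma gaussCdf_zero : gaussCdf 0 = 1 / 2 := by
  have := gaussCdf_neg 0
  rw [neg_zero] at this
  linarith

lemma gaussCdfInv_gaussCdf (x : ℝ) : gaussCdfInv (gaussCdf x) = x :=
  Function.leftInverse_invFun strictMono_gaussCdf.injective x

lemma gaussCdf_gaussCdfInv {a : ℝ} (ha : a ∈ Ioo (0 : ℝ) 1) : gaussCdf (gaussCdfInv a) = a := by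
  refine Function.invFun_eq ?_
  exact mem_range_of_exists_le_of_exists_ge continuous_gaussCdf
    ((tendsto_gaussCdf_atBot.eventually (ge_mem_nhds ha.1)).exists)
    ((tendsto_gaussCdf_atTop.eventually (le_mem_nhds ha.2)).exists)

lemma strictMonoOn_gaussCdfInv : StrictMonoOn gaussCdfInv (Ioo 0 1) := fun a ha b hb hab => by
  rw [← strictMono_gaussCdf.lt_iff_lt, gaussCdf_gaussCdfInv ha, gaussCdf_gaussCdfInv hb]
  exact hab

lemma continuousAt_gaussCdfInv {a : ℝ} (ha : a ∈ Ioo (0 : ℝ) 1) : ContinuousAt gaussCdfInv a := by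
  refine strictMonoOn_gaussCdfInv.continuousAt_of_image_mem_nhds (Ioo_mem_nhds ha.1 ha.2) ?_
  convert! univ_mem
  exact eq_univ_of_forall fun x => ⟨_, gaussCdf_mem_Ioo x, gaussCdfInv_gaussCdf x⟩

lemma gaussCdfInv_one_sub {a : ℝ} (ha : a ∈ Ioo (0 : ℝ) 1) :
    gaussCdfInv (1 - a) = -gaussCdfInv a := by
  conv_lhs => rw [← gaussCdf_gaussCdfInv ha, ← gaussCdf_neg, gaussCdfInv_gaussCdf]

/-- The Gaussian isoperimetric profile `φ ∘ Φ⁻¹`, without a convention outside `(0, 1)`. -/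
noncomputable def gaussProfile (a : ℝ) : ℝ := gaussPhi (gaussCdfInv a)

lemma gaussProfile_pos (a : ℝ) : 0 < gaussProfile a := gaussPhi_pos _

lemma gaussProfile_le_one (a : ℝ) : gaussProfile a ≤ 1 := gaussPhi_le_one _

lemma gaussProfile_gaussCdf (x : ℝ) : gaussProfile (gaussCdf x) = gaussPhi x := by
  rw [gaussProfile, gaussCdfInv_gaussCdf]

lemma hasDerivAt_gaussCdfInv {a : ℝ} (ha : a ∈ Ioo (0 : ℝ) 1) :
    HasDerivAt gaussCdfInv (gaussProfile a)⁻¹ a :=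
  (hasDerivAt_gaussCdf _).of_local_left_inverse (continuousAt_gaussCdfInv ha) (gaussPhi_pos _).ne'
    (eventually_of_mem (Ioo_mem_nhds ha.1 ha.2) fun _ hb => gaussCdf_gaussCdfInv hb)

lemma hasDerivAt_gaussProfile {a : ℝ} (ha : a ∈ Ioo (0 : ℝ) 1) :
    HasDerivAt gaussProfile (-gaussCdfInv a) a := by
  have h := (hasDerivAt_gaussPhi (gaussCdfInv a)).comp a (hasDerivAt_gaussCdfInv ha)
  convert! h using 1
  have := gaussPhi_pos (gaussCdfInv a)
  unfold gaussProfile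
  field_simp

lemma continuousAt_gaussProfile {a : ℝ} (ha : a ∈ Ioo (0 : ℝ) 1) : ContinuousAt gaussProfile a :=
  (hasDerivAt_gaussProfile ha).continuousAt

lemma Continuous.gaussProfile_comp {X : Type*} [TopologicalSpace X] {f : X → ℝ} (hc : Continuous f)
    (hf : ∀ x, f x ∈ Ioo (0 : ℝ) 1) : Continuous fun x => gaussProfile (f x) :=
  continuous_iff_continuousAt.2 fun x =>
    ContinuousAt.comp (f := f) (continuousAt_gaussProfile (hf x)) hc.continuousAt

lemma nonneg_of_hasDerivAt_nonneg {g g' : ℝ → ℝ} {x : ℝ}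
    (hg : ∀ y ∈ Icc 0 x, HasDerivAt g (g' y) y) (hg' : ∀ y ∈ Icc 0 x, 0 ≤ g' y) (h0 : g 0 = 0) :
    ∀ y ∈ Icc 0 x, 0 ≤ g y := by
  intro y hy
  have hm : MonotoneOn g (Icc 0 x) := by
    refine monotoneOn_of_hasDerivWithinAt_nonneg (f' := g') (convex_Icc 0 x)
      (fun z hz => (hg z hz).continuousAt.continuousWithinAt)
      (fun z hz => (hg z (interior_subset hz)).hasDerivWithinAt)
      (fun z hz => hg' z (interior_subset hz))
  rw [← h0]
  exact hm ⟨le_rfl, hy.1.trans hy.2⟩ hy hy.1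

lemma gaussPhi_le_gaussPhi {x y : ℝ} (h : y ^ 2 ≤ x ^ 2) : gaussPhi x ≤ gaussPhi y := by
  unfold gaussPhi
  gcongr

lemma gaussProfile_one_sub {a : ℝ} (ha : a ∈ Ioo (0 : ℝ) 1) :
    gaussProfile (1 - a) = gaussProfile a := by
  rw [gaussProfile, gaussCdfInv_one_sub ha, gaussPhi_neg, gaussProfile]

lemma two_mul_sq_gaussCdfInv_le {c x : ℝ} (hp : c + x < 1) (hm : 0 < c - x) :
    ∀ y ∈ Icc 0 x, 2 * gaussCdfInv c ^ 2 ≤ gaussCdfInv (c + y) ^ 2 + gaussCdfInv (c - y) ^ 2 := by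
  have hP : ∀ y ∈ Icc 0 x, c + y ∈ Ioo (0 : ℝ) 1 := fun y hy =>
    ⟨by linarith [hy.1, hy.2], by linarith [hy.1, hy.2]⟩
  have hM : ∀ y ∈ Icc 0 x, c - y ∈ Ioo (0 : ℝ) 1 := fun y hy =>
    ⟨by linarith [hy.1, hy.2], by linarith [hy.1, hy.2]⟩
  have hratio : ∀ a ∈ Ioo (0 : ℝ) 1, HasDerivAt (fun z => gaussCdfInv z / gaussProfile z)
      ((1 + gaussCdfInv a ^ 2) / gaussProfile a ^ 2) a := fun a ha => by
    have hpos := gaussProfile_pos a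
    convert! (hasDerivAt_gaussCdfInv ha).div (hasDerivAt_gaussProfile ha) hpos.ne' using 1
    field_simp
    ring
  have hmono : MonotoneOn (fun z => gaussCdfInv z / gaussProfile z) (Ioo 0 1) :=
    monotoneOn_of_hasDerivWithinAt_nonneg (convex_Ioo 0 1)
      (fun z hz => (hratio z hz).continuousAt.continuousWithinAt)
      (fun z hz => (hratio z (interior_subset hz)).hasDerivWithinAt)
      (fun z _ => by positivity)
  have := nonneg_of_hasDerivAt_nonneg (x := x)
    (g := fun y => gaussCdfInv (c + y) ^ 2 + gaussCdfInv (c - y) ^ 2 - 2 * gaussCdfInv c ^ 2)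
    (g' := fun y => 2 * (gaussCdfInv (c + y) / gaussProfile (c + y) -
      gaussCdfInv (c - y) / gaussProfile (c - y))) ?_ ?_ (by simp; ring)
  · intro y hy; linarith [this y hy]
  · intro y hy
    have h1 := ((hasDerivAt_gaussCdfInv (hP y hy)).comp_const_add c y).pow 2
    have h2 := ((hasDerivAt_gaussCdfInv (hM y hy)).comp_const_sub c y).pow 2
    convert! (h1.add h2).sub_const (2 * gaussCdfInv c ^ 2) using 1
    simp
    ring
  · intro y hy
    have := hmono (hM y hy) (hP y hy) (by linarith [hy.1])
    simp only at this
    linarith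

lemma hasDerivAt_sq_gaussProfile {a : ℝ} (ha : a ∈ Ioo (0 : ℝ) 1) :
    HasDerivAt (fun z => gaussProfile z ^ 2) (-2 * (gaussProfile a * gaussCdfInv a)) a := by
  convert! (hasDerivAt_gaussProfile ha).pow 2 using 1
  simp; ring

lemma hasDerivAt_gaussProfile_mul_gaussCdfInv {a : ℝ} (ha : a ∈ Ioo (0 : ℝ) 1) :
    HasDerivAt (fun z => gaussProfile z * gaussCdfInv z) (1 - gaussCdfInv a ^ 2) a := by
  have hpos := gaussProfile_pos a
  convert! (hasDerivAt_gaussProfile ha).mul (hasDerivAt_gaussCdfInv ha) using 1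
  field_simp; ring

lemma sq_gaussProfile_add_ge {c x : ℝ} (hp : c + x < 1) (hm : 0 < c - x) (hx : 0 ≤ x) :
    2 * gaussProfile c ^ 2 + 2 * gaussCdfInv c ^ 2 * x ^ 2 ≤
      (gaussProfile (c + x) ^ 2 + x ^ 2) + (gaussProfile (c - x) ^ 2 + x ^ 2) := by
  have hP : ∀ y ∈ Icc 0 x, c + y ∈ Ioo (0 : ℝ) 1 := fun y hy =>
    ⟨by linarith [hy.1, hy.2], by linarith [hy.1, hy.2]⟩
  have hM : ∀ y ∈ Icc 0 x, c - y ∈ Ioo (0 : ℝ) 1 := fun y hy =>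
    ⟨by linarith [hy.1, hy.2], by linarith [hy.1, hy.2]⟩
  have h1 := nonneg_of_hasDerivAt_nonneg (x := x)
    (g := fun y => -2 * (gaussProfile (c + y) * gaussCdfInv (c + y)) +
      2 * (gaussProfile (c - y) * gaussCdfInv (c - y)) + (4 - 4 * gaussCdfInv c ^ 2) * y)
    (g' := fun y => 2 * (gaussCdfInv (c + y) ^ 2 + gaussCdfInv (c - y) ^ 2 -
      2 * gaussCdfInv c ^ 2)) ?_ ?_ (by simp)
  · have h2 := nonneg_of_hasDerivAt_nonneg (x := x)
      (g := fun y => gaussProfile (c + y) ^ 2 + gaussProfile (c - y) ^ 2 +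
        (2 - 2 * gaussCdfInv c ^ 2) * y ^ 2 - 2 * gaussProfile c ^ 2)
      ?_ h1 (by simp; ring) x ⟨hx, le_rfl⟩
    · linarith
    · intro y hy
      have e1 := (hasDerivAt_sq_gaussProfile (hP y hy)).comp_const_add c y
      have e2 := (hasDerivAt_sq_gaussProfile (hM y hy)).comp_const_sub c y
      convert! ((e1.add e2).add ((hasDerivAt_pow 2 y).const_mul
        (2 - 2 * gaussCdfInv c ^ 2))).sub_const (2 * gaussProfile c ^ 2) using 1
      simp; ring
  · intro y hy
    have e1 := ((hasDerivAt_gaussProfile_mul_gaussCdfInv (hP y hy)).comp_const_add c y).const_mul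
      (-2)
    have e2 := ((hasDerivAt_gaussProfile_mul_gaussCdfInv (hM y hy)).comp_const_sub c y).const_mul 2
    convert! (e1.add e2).add ((hasDerivAt_id y).const_mul (4 - 4 * gaussCdfInv c ^ 2)) using 1
    ring
  · intro y hy
    linarith [two_mul_sq_gaussCdfInv_le hp hm y hy]

lemma sq_gaussProfile_sub_mem {c x : ℝ} (hp : c + x < 1) (hm : 0 < c - x) (hx : 0 ≤ x)
    (hc : c ≤ 1 / 2) :
    gaussProfile (c + x) ^ 2 - gaussProfile (c - x) ^ 2 ∈
      Icc 0 (-4 * (gaussProfile c * gaussCdfInv c) * x) := by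
  have hP : ∀ y ∈ Icc 0 x, c + y ∈ Ioo (0 : ℝ) 1 := fun y hy =>
    ⟨by linarith [hy.1, hy.2], by linarith [hy.1, hy.2]⟩
  have hM : ∀ y ∈ Icc 0 x, c - y ∈ Ioo (0 : ℝ) 1 := fun y hy =>
    ⟨by linarith [hy.1, hy.2], by linarith [hy.1, hy.2]⟩
  have hq : ∀ y ∈ Icc 0 x, gaussCdfInv (c + y) ^ 2 ≤ gaussCdfInv (c - y) ^ 2 := by
    intro y hy
    have h1 : gaussCdfInv (c - y) ≤ gaussCdfInv (c + y) :=
      strictMonoOn_gaussCdfInv.monotoneOn (hM y hy) (hP y hy) (by linarith [hy.1])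
    have h2 : gaussCdfInv (c + y) ≤ -gaussCdfInv (c - y) := by
      rw [← gaussCdfInv_one_sub (hM y hy)]
      refine strictMonoOn_gaussCdfInv.monotoneOn (hP y hy) ?_ (by linarith)
      constructor <;> linarith [(hM y hy).1, (hM y hy).2]
    nlinarith
  constructor
  · have := gaussPhi_le_gaussPhi (hq x ⟨hx, le_rfl⟩)
    have h0 := gaussPhi_pos (gaussCdfInv (c - x))
    simp only [gaussProfile]
    nlinarith
  · have h1 := nonneg_of_hasDerivAt_nonneg (x := x)
      (g := fun y => 2 * (gaussProfile (c + y) * gaussCdfInv (c + y)) +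
        2 * (gaussProfile (c - y) * gaussCdfInv (c - y)) -
        4 * (gaussProfile c * gaussCdfInv c))
      (g' := fun y => 2 * (gaussCdfInv (c - y) ^ 2 - gaussCdfInv (c + y) ^ 2)) ?_ ?_
      (by simp; ring)
    · have h2 := nonneg_of_hasDerivAt_nonneg (x := x)
        (g := fun y => -4 * (gaussProfile c * gaussCdfInv c) * y -
          (gaussProfile (c + y) ^ 2 - gaussProfile (c - y) ^ 2))
        ?_ h1 (by simp) x ⟨hx, le_rfl⟩
      · linarith
      · intro y hy
        have e1 := (hasDerivAt_sq_gaussProfile (hP y hy)).comp_const_add c y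
        have e2 := (hasDerivAt_sq_gaussProfile (hM y hy)).comp_const_sub c y
        convert! ((hasDerivAt_id y).const_mul
          (-4 * (gaussProfile c * gaussCdfInv c))).sub (e1.sub e2) using 1
        ring
    · intro y hy
      have e1 := ((hasDerivAt_gaussProfile_mul_gaussCdfInv (hP y hy)).comp_const_add c y).const_mul 2
      have e2 := ((hasDerivAt_gaussProfile_mul_gaussCdfInv (hM y hy)).comp_const_sub c y).const_mul 2
      convert! (e1.add e2).sub_const (4 * (gaussProfile c * gaussCdfInv c)) using 1
      ring
    · intro y hy
      linarith [hq y hy]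

lemma two_mul_le_sqrt_add_sqrt {u v j : ℝ} (hu : 0 ≤ u) (hv : 0 ≤ v)
    (h : (u - v) ^ 2 ≤ 8 * j ^ 2 * (u + v - 2 * j ^ 2)) : 2 * j ≤ √u + √v := by
  by_contra! hlt
  have hA := Real.sqrt_nonneg u
  have hB := Real.sqrt_nonneg v
  have eA := Real.sq_sqrt hu
  have eB := Real.sq_sqrt hv
  set A := √u
  set B := √v
  rw [← eA, ← eB] at h
  have h1 : 0 < 4 * j ^ 2 - (A + B) ^ 2 := by nlinarith
  have h2 : 0 < 4 * j ^ 2 - (A - B) ^ 2 := by nlinarith [mul_nonneg hA hB]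
  nlinarith [mul_pos h1 h2]

/-- **Bobkov's two-point inequality.** -/
lemma bobkov_two_point {a b : ℝ} (ha : a ∈ Ioo (0 : ℝ) 1) (hb : b ∈ Ioo (0 : ℝ) 1) :
    gaussProfile ((a + b) / 2) ≤ (√(gaussProfile a ^ 2 + ((a - b) / 2) ^ 2) +
      √(gaussProfile b ^ 2 + ((a - b) / 2) ^ 2)) / 2 := by
  wlog hab : b ≤ a generalizing a b
  · have := this hb ha (le_of_not_ge hab)
    rw [add_comm a b, add_comm (√_), show ((a - b) / 2) ^ 2 = ((b - a) / 2) ^ 2 by ring]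
    exact this
  wlog hc : (a + b) / 2 ≤ 1 / 2 generalizing a b
  · have ha' : 1 - a ∈ Ioo (0 : ℝ) 1 := ⟨by linarith [ha.2], by linarith [ha.1]⟩
    have hb' : 1 - b ∈ Ioo (0 : ℝ) 1 := ⟨by linarith [hb.2], by linarith [hb.1]⟩
    have := this hb' ha' (by linarith) (by linarith)
    rw [gaussProfile_one_sub ha, gaussProfile_one_sub hb,
      show (1 - b + (1 - a)) / 2 = 1 - (a + b) / 2 by ring, gaussProfile_one_sub
        ⟨by linarith [ha.1, hb.1], by linarith [ha.2, hb.2]⟩,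
      show (1 - b - (1 - a)) / 2 = (a - b) / 2 by ring] at this
    linarith
  have hx : 0 ≤ (a - b) / 2 := by linarith
  have e1 : (a + b) / 2 + (a - b) / 2 = a := by ring
  have e2 : (a + b) / 2 - (a - b) / 2 = b := by ring
  have hS := sq_gaussProfile_add_ge (c := (a + b) / 2) (x := (a - b) / 2)
    (by rw [e1]; exact ha.2) (by rw [e2]; exact hb.1) hx
  have hD := sq_gaussProfile_sub_mem (c := (a + b) / 2) (x := (a - b) / 2)
    (by rw [e1]; exact ha.2) (by rw [e2]; exact hb.1) hx hc
  rw [e1, e2] at hS hD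
  have := two_mul_le_sqrt_add_sqrt (u := gaussProfile a ^ 2 + ((a - b) / 2) ^ 2)
    (v := gaussProfile b ^ 2 + ((a - b) / 2) ^ 2) (j := gaussProfile ((a + b) / 2))
    (by positivity) (by positivity) ?_
  · linarith
  · set j := gaussProfile ((a + b) / 2)
    set q := gaussCdfInv ((a + b) / 2)
    set x := (a - b) / 2
    have h1 : (gaussProfile a ^ 2 - gaussProfile b ^ 2) ^ 2 ≤ (-4 * (j * q) * x) ^ 2 :=
      pow_le_pow_left₀ hD.1 hD.2 2
    have h2 : 8 * j ^ 2 * (2 * q ^ 2 * x ^ 2) ≤ 8 * j ^ 2 * (gaussProfile a ^ 2 + x ^ 2 +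
        (gaussProfile b ^ 2 + x ^ 2) - 2 * j ^ 2) :=
      mul_le_mul_of_nonneg_left (by linarith) (by positivity)
    nlinarith

lemma sqrt_sq_add_sq_average_le (a b c d : ℝ) :
    √(((a + b) / 2) ^ 2 + ((c + d) / 2) ^ 2) ≤ (√(a ^ 2 + c ^ 2) + √(b ^ 2 + d ^ 2)) / 2 := by
  rw [Real.sqrt_le_left (by positivity)]
  have h1 := Real.sq_sqrt (show 0 ≤ a ^ 2 + c ^ 2 by positivity)
  have h2 := Real.sq_sqrt (show 0 ≤ b ^ 2 + d ^ 2 by positivity)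
  have h3 : a * b + c * d ≤ √(a ^ 2 + c ^ 2) * √(b ^ 2 + d ^ 2) := by
    rw [← Real.sqrt_mul (by positivity)]
    refine Real.le_sqrt_of_sq_le ?_
    nlinarith [sq_nonneg (a * d - b * c)]
  nlinarith

/-- Average of `f` over one step `±δ` of the simple random walk. -/
noncomputable def signAvg (δ : ℝ) (f : ℝ → ℝ) (x : ℝ) : ℝ := (f (x + δ) + f (x - δ)) / 2

lemma signAvg_iterate_mono {δ : ℝ} (N : ℕ) {f g : ℝ → ℝ} (h : ∀ x, f x ≤ g x) (x : ℝ) :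
    (signAvg δ)^[N] f x ≤ (signAvg δ)^[N] g x := by
  induction N generalizing f g with
  | zero => exact h x
  | succ N ih =>
    refine ih fun y => ?_
    unfold signAvg
    linarith [h (y + δ), h (y - δ)]

lemma signAvg_iterate_mem_Ioo {δ : ℝ} (N : ℕ) {f : ℝ → ℝ} (h : ∀ x, f x ∈ Ioo (0 : ℝ) 1) (x : ℝ) :
    (signAvg δ)^[N] f x ∈ Ioo (0 : ℝ) 1 := by
  induction N generalizing f with
  | zero => exact h x
  | succ N ih =>
    refine ih fun y => ?_
    have h1 := h (y + δ)
    have h2 := h (y - δ)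
    unfold signAvg
    constructor <;> linarith [h1.1, h1.2, h2.1, h2.2]

lemma signAvg_iterate_sub_shift {δ : ℝ} (N : ℕ) (f : ℝ → ℝ) (s x : ℝ) :
    ((signAvg δ)^[N] f x - (signAvg δ)^[N] f (x + s)) / 2 =
      (signAvg δ)^[N] (fun u => (f u - f (u + s)) / 2) x := by
  induction N generalizing f with
  | zero => rfl
  | succ N ih =>
    rw [Function.iterate_succ_apply, ih, Function.iterate_succ_apply]
    refine congrFun (congrArg _ (funext fun u => ?_)) x
    unfold signAvg
    rw [show u + s + δ = u + δ + s by ring, show u + s - δ = u - δ + s by ring]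
    ring

lemma signAvg_iterate_neg {δ : ℝ} (N : ℕ) (f : ℝ → ℝ) (x : ℝ) :
    (signAvg δ)^[N] (fun u => -f u) x = -(signAvg δ)^[N] f x := by
  induction N generalizing f with
  | zero => rfl
  | succ N ih =>
    rw [Function.iterate_succ_apply, Function.iterate_succ_apply, ← ih]
    refine congrFun (congrArg _ (funext fun u => ?_)) x
    unfold signAvg
    ring

lemma abs_signAvg_iterate_le {δ : ℝ} (N : ℕ) {f m : ℝ → ℝ} (h : ∀ x, |f x| ≤ m x) (x : ℝ) :
    |(signAvg δ)^[N] f x| ≤ (signAvg δ)^[N] m x := by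
  rw [abs_le]
  constructor
  · rw [← signAvg_iterate_neg]
    exact signAvg_iterate_mono N (fun y => (abs_le.1 (h y)).1) x
  · exact signAvg_iterate_mono N (fun y => (abs_le.1 (h y)).2) x

lemma sqrt_sq_signAvg_iterate_le {δ : ℝ} (N : ℕ) (f g : ℝ → ℝ) (x : ℝ) :
    √((signAvg δ)^[N] f x ^ 2 + (signAvg δ)^[N] g x ^ 2) ≤
      (signAvg δ)^[N] (fun u => √(f u ^ 2 + g u ^ 2)) x := by
  induction N generalizing f g with
  | zero => exact le_rfl
  | succ N ih =>
    refine (ih _ _).trans (signAvg_iterate_mono N (fun y => ?_) x)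
    exact sqrt_sq_add_sq_average_le _ _ _ _

/-- Bobkov's inequality for the simple random walk with step `δ`. -/
lemma bobkov_signAvg {δ : ℝ} {f m : ℝ → ℝ} (hf : ∀ x, f x ∈ Ioo (0 : ℝ) 1)
    (hm : ∀ u, |(f u - f (u + 2 * δ)) / 2| ≤ m u)
    (hm' : ∀ u, |(f u - f (u + -(2 * δ))) / 2| ≤ m u) (N : ℕ) (x : ℝ) :
    gaussProfile ((signAvg δ)^[N] f x) ≤
      (signAvg δ)^[N] (fun u => √(gaussProfile (f u) ^ 2 + N * m u ^ 2)) x := by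
  induction N generalizing x with
  | zero => simp [Real.sqrt_sq (gaussProfile_pos _).le]
  | succ N ih =>
    have key : ∀ s y, (∀ u, |(f u - f (u + s)) / 2| ≤ m u) →
        √(gaussProfile ((signAvg δ)^[N] f y) ^ 2 +
          (((signAvg δ)^[N] f y - (signAvg δ)^[N] f (y + s)) / 2) ^ 2) ≤
        (signAvg δ)^[N] (fun u => √(gaussProfile (f u) ^ 2 + (N + 1 : ℕ) * m u ^ 2)) y := by
      intro s y hs
      have h1 : |((signAvg δ)^[N] f y - (signAvg δ)^[N] f (y + s)) / 2| ≤ (signAvg δ)^[N] m y := by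
        rw [signAvg_iterate_sub_shift]
        exact abs_signAvg_iterate_le N hs y
      have h2 := gaussProfile_pos ((signAvg δ)^[N] f y)
      calc _ ≤ √((signAvg δ)^[N] (fun u => √(gaussProfile (f u) ^ 2 + N * m u ^ 2)) y ^ 2 +
            (signAvg δ)^[N] m y ^ 2) := by
            refine Real.sqrt_le_sqrt (add_le_add ?_ ?_)
            · exact pow_le_pow_left₀ h2.le (ih y) 2
            · rw [← sq_abs]
              exact pow_le_pow_left₀ (abs_nonneg _) h1 2
        _ ≤ _ := sqrt_sq_signAvg_iterate_le N _ _ y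
        _ = _ := by
            refine congrFun (congrArg _ (funext fun u => ?_)) y
            rw [Real.sq_sqrt (by positivity)]
            push_cast
            congr 1
            ring
    rw [Function.iterate_succ_apply', Function.iterate_succ_apply']
    have h1 := key (-(2 * δ)) (x + δ) hm'
    have h2 := key (2 * δ) (x - δ) hm
    rw [show x + δ + -(2 * δ) = x - δ by ring] at h1
    rw [show x - δ + 2 * δ = x + δ by ring] at h2
    have h3 := bobkov_two_point (signAvg_iterate_mem_Ioo (δ := δ) N hf (x + δ))
      (signAvg_iterate_mem_Ioo (δ := δ) N hf (x - δ))
    rw [show ∀ a b : ℝ, ((a - b) / 2) ^ 2 = ((b - a) / 2) ^ 2 by intros; ring] at h2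
    simp only [signAvg]
    refine h3.trans ?_
    linarith

/-- Law at time `N` of the simple random walk with step `δ` started at the origin. -/
noncomputable def walkMeasure (δ : ℝ) : ℕ → Measure ℝ
  | 0 => Measure.dirac 0
  | N + 1 => (2⁻¹ : ℝ≥0∞) • (walkMeasure δ N).map (fun x => x + δ) +
      (2⁻¹ : ℝ≥0∞) • (walkMeasure δ N).map (fun x => x + -δ)

instance isProbabilityMeasure_walkMeasure (δ : ℝ) (N : ℕ) :
    IsProbabilityMeasure (walkMeasure δ N) := by
  induction N with
  | zero => exact Measure.dirac.isProbabilityMeasure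
  | succ N ih =>
    refine ⟨?_⟩
    have h (c : ℝ) : (walkMeasure δ N).map (fun x => x + c) univ = 1 :=
      (Measure.isProbabilityMeasure_map (by fun_prop)).measure_univ
    simp only [walkMeasure, Measure.add_apply, Measure.smul_apply, h, smul_eq_mul, mul_one]
    exact ENNReal.inv_two_add_inv_two

lemma integrable_of_continuous_of_abs_le {X : Type*} [TopologicalSpace X] [MeasurableSpace X]
    [OpensMeasurableSpace X] {μ : Measure X} [IsFiniteMeasure μ] {f : X → ℝ} {C : ℝ}
    (hc : Continuous f) (hb : ∀ x, |f x| ≤ C) : Integrable f μ :=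
  Integrable.of_bound hc.measurable.aestronglyMeasurable C (Eventually.of_forall hb)

lemma signAvg_iterate_zero_eq_integral (δ : ℝ) (N : ℕ) {f : ℝ → ℝ} {C : ℝ} (hc : Continuous f)
    (hb : ∀ x, |f x| ≤ C) : (signAvg δ)^[N] f 0 = ∫ x, f x ∂(walkMeasure δ N) := by
  induction N generalizing f with
  | zero => simp [walkMeasure]
  | succ N ih =>
    have hi (μ : Measure ℝ) [IsFiniteMeasure μ] : Integrable f μ :=
      integrable_of_continuous_of_abs_le hc hb
    have hs (c : ℝ) : Integrable (fun x => f (x + c)) (walkMeasure δ N) :=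
      integrable_of_continuous_of_abs_le (by fun_prop) fun x => hb _
    rw [Function.iterate_succ_apply, ih]
    · rw [walkMeasure, integral_add_measure, integral_smul_measure, integral_smul_measure,
        integral_map (by fun_prop) hc.measurable.aestronglyMeasurable,
        integral_map (by fun_prop) hc.measurable.aestronglyMeasurable]
      · simp only [signAvg, sub_eq_add_neg]
        rw [integral_div, integral_add (hs _) (hs _)]
        simp
        ring
      · exact (hi _).smul_measure (by simp)
      · exact (hi _).smul_measure (by simp)
    · unfold signAvg; fun_prop
    · intro x
      have h1 := abs_le.1 (hb (x + δ))
      have h2 := abs_le.1 (hb (x - δ))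
      unfold signAvg
      rw [abs_le]
      constructor <;> linarith [h1.1, h1.2, h2.1, h2.2]

lemma charFun_walkMeasure (δ : ℝ) (N : ℕ) (t : ℝ) :
    charFun (walkMeasure δ N) t = Complex.cos (δ * t) ^ N := by
  induction N with
  | zero => simp [walkMeasure]
  | succ N ih =>
    have h : charFun (walkMeasure δ (N + 1)) t =
        2⁻¹ * charFun ((walkMeasure δ N).map (fun x => x + δ)) t +
        2⁻¹ * charFun ((walkMeasure δ N).map (fun x => x + -δ)) t := by
      have hi (μ : Measure ℝ) [IsFiniteMeasure μ] :
          Integrable (fun x : ℝ => Complex.exp (t * x * Complex.I)) μ := by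
        refine Integrable.of_bound (C := 1)
          (Continuous.measurable (by fun_prop)).aestronglyMeasurable (Eventually.of_forall fun x => ?_)
        rw [← Complex.ofReal_mul, Complex.norm_exp_ofReal_mul_I]
      simp only [charFun_apply_real]
      rw [walkMeasure, integral_add_measure ((hi _).smul_measure (by simp))
        ((hi _).smul_measure (by simp)), integral_smul_measure, integral_smul_measure]
      simp
    rw [h, charFun_map_add_const, charFun_map_add_const, ih, Complex.cos]
    simp only [RCLike.inner_apply, conj_trivial]
    push_cast
    rw [mul_comm (t : ℂ) (-(δ : ℂ)), mul_comm (t : ℂ) (δ : ℂ)]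
    ring_nf

lemma tendsto_integral_walkMeasure {h : ℝ → ℝ} {C : ℝ} (hc : Continuous h)
    (hb : ∀ x, |h x| ≤ C) :
    Tendsto (fun N : ℕ => ∫ x, h x ∂(walkMeasure (√N)⁻¹ N)) atTop
      (𝓝 (∫ x, h x ∂(gaussianReal 0 1))) := by
  have hm : ∫ x, x ∂(walkMeasure 1 1) = 0 := by
    rw [walkMeasure, walkMeasure, Measure.map_dirac' (measurable_add_const _),
      Measure.map_dirac' (measurable_add_const _), integral_add_measure, integral_smul_measure, integral_smul_measure]
    · simp
    · exact (integrable_dirac (by simp)).smul_measure (by simp)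
    · exact (integrable_dirac (by simp)).smul_measure (by simp)
  have hv : ∫ x, x ^ 2 ∂(walkMeasure 1 1) = 1 := by
    rw [walkMeasure, walkMeasure, Measure.map_dirac' (measurable_add_const _),
      Measure.map_dirac' (measurable_add_const _), integral_add_measure, integral_smul_measure, integral_smul_measure]
    · simp; norm_num
    · exact (integrable_dirac (by simp)).smul_measure (by simp)
    · exact (integrable_dirac (by simp)).smul_measure (by simp)
  let μ (N : ℕ) : ProbabilityMeasure ℝ := ⟨walkMeasure (√N)⁻¹ N, inferInstance⟩
  let γ : ProbabilityMeasure ℝ := ⟨gaussianReal 0 1, inferInstance⟩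
  have key : Tendsto μ atTop (𝓝 γ) := by
    rw [ProbabilityMeasure.tendsto_iff_tendsto_charFun]
    intro t
    have h0 := tendsto_charFun_inv_sqrt_mul_pow (P := walkMeasure 1 1) (X := id)
      aemeasurable_id hm hv t
    simp only [Measure.map_id, charFun_walkMeasure, pow_one] at h0
    simp only [μ, γ, ProbabilityMeasure.coe_mk, charFun_walkMeasure, charFun_gaussianReal]
    convert! h0 using 2
    · simp
    · congr 1; simp; ring
  exact (ProbabilityMeasure.tendsto_iff_forall_integral_tendsto.1 key)
    (BoundedContinuousFunction.ofNormedAddCommGroup h hc C hb)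

lemma integral_mem_Ioo_of_continuous {X : Type*} [TopologicalSpace X] [MeasurableSpace X]
    [OpensMeasurableSpace X] {μ : Measure X} [IsProbabilityMeasure μ] {f : X → ℝ}
    (hc : Continuous f) (hf : ∀ x, f x ∈ Ioo (0 : ℝ) 1) : ∫ x, f x ∂μ ∈ Ioo (0 : ℝ) 1 := by
  have key (g : X → ℝ) (hg : Continuous g) (h : ∀ x, g x ∈ Ioo (0 : ℝ) 1) : 0 < ∫ x, g x ∂μ := by
    rw [integral_pos_iff_support_of_nonneg (fun x => (h x).1.le)
      (integrable_of_continuous_of_abs_le hg (C := 1) fun x => by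
        rw [abs_of_pos (h x).1]; exact (h x).2.le)]
    rw [show Function.support g = univ from eq_univ_of_forall fun x => (h x).1.ne', measure_univ]
    exact one_pos
  refine ⟨key f hc hf, ?_⟩
  have h1 := key (fun x => 1 - f x) (by fun_prop) fun x =>
    ⟨by linarith [(hf x).2], by linarith [(hf x).1]⟩
  rw [integral_sub (integrable_const _) (integrable_of_continuous_of_abs_le hc (C := 1) fun x => by
        rw [abs_of_pos (hf x).1]; exact (hf x).2.le)] at h1
  simp at h1
  exact h1

lemma sqrt_gaussProfile_sq_add_sq_mem {a b C : ℝ} (hb : |b| ≤ C) :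
    |√(gaussProfile a ^ 2 + b ^ 2)| ≤ 1 + C := by
  have h1 := gaussProfile_le_one a
  have h2 := (gaussProfile_pos a).le
  have h3 := abs_nonneg b
  rw [abs_of_nonneg (Real.sqrt_nonneg _), Real.sqrt_le_left (by linarith), ← sq_abs b]
  nlinarith

/-- Bobkov's inequality on the line, with a modulus `m` dominating the local slopes. -/
lemma bobkov_gaussianReal_of_slope {f m : ℝ → ℝ} {C η : ℝ} (hη : 0 < η) (hc : Continuous f)
    (hf : ∀ x, f x ∈ Ioo (0 : ℝ) 1) (hmc : Continuous m) (hmC : ∀ x, |m x| ≤ C)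
    (hm : ∀ u s, |s| ≤ η → |f u - f (u + s)| ≤ |s| * m u) :
    gaussProfile (∫ x, f x ∂(gaussianReal 0 1)) ≤
      ∫ x, √(gaussProfile (f x) ^ 2 + m x ^ 2) ∂(gaussianReal 0 1) := by
  have hf1 : ∀ x, |f x| ≤ 1 := fun x => by rw [abs_of_pos (hf x).1]; exact (hf x).2.le
  have hgc : Continuous fun x => √(gaussProfile (f x) ^ 2 + m x ^ 2) := by
    have := hc.gaussProfile_comp hf
    fun_prop
  have hgC : ∀ x, |√(gaussProfile (f x) ^ 2 + m x ^ 2)| ≤ 1 + C := fun x =>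
    sqrt_gaussProfile_sq_add_sq_mem (hmC x)
  have h1 := (continuousAt_gaussProfile (integral_mem_Ioo_of_continuous
    (μ := gaussianReal 0 1) hc hf)).tendsto.comp (tendsto_integral_walkMeasure hc hf1)
  have h2 := tendsto_integral_walkMeasure hgc hgC
  refine le_of_tendsto_of_tendsto h1 h2 ?_
  have h3 : Tendsto (fun N : ℕ => 2 * (√(N : ℝ))⁻¹) atTop (𝓝 (2 * 0)) :=
    (tendsto_inv_atTop_zero.comp
      (tendsto_sqrt_atTop.comp tendsto_natCast_atTop_atTop)).const_mul 2
  rw [mul_zero] at h3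
  filter_upwards [h3.eventually (ge_mem_nhds hη), eventually_gt_atTop 0] with N hN hN0
  have hN0' : (0 : ℝ) < N := by exact_mod_cast hN0
  set δ := (√(N : ℝ))⁻¹ with hδ
  have hδ0 : 0 < δ := by positivity
  simp only [Function.comp]
  rw [← signAvg_iterate_zero_eq_integral δ N hc hf1, ← signAvg_iterate_zero_eq_integral δ N hgc hgC]
  have h4 (s u : ℝ) (hs : |s| = 2 * δ) : |(f u - f (u + s)) / 2| ≤ δ * m u := by
    have := hm u s (hs ▸ hN)
    rw [abs_div, abs_of_pos (by norm_num : (0 : ℝ) < 2), hs] at *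
    linarith
  have h5 := bobkov_signAvg (m := fun u => δ * m u) hf
    (fun u => h4 (2 * δ) u (abs_of_pos (by positivity)))
    (fun u => h4 (-(2 * δ)) u (by rw [abs_neg, abs_of_pos (by positivity)])) N 0
  convert! h5 using 3
  congr 2
  rw [hδ, mul_pow, inv_pow, Real.sq_sqrt hN0'.le]
  field_simp

lemma continuous_sSup_abs_Icc {g : ℝ → ℝ} (hg : Continuous g) (η : ℝ) :
    Continuous fun u => sSup ((fun s => |g (u + s)|) '' Icc (-η) η) :=
  isCompact_Icc.continuous_sSup (f := fun u s => |g (u + s)|) (by fun_prop)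

/-- Bobkov's inequality on the line. -/
lemma bobkov_gaussianReal {f f' : ℝ → ℝ} {C : ℝ} (hf : ∀ x, f x ∈ Ioo (0 : ℝ) 1)
    (hd : ∀ x, HasDerivAt f (f' x) x) (hc' : Continuous f') (hC : ∀ x, |f' x| ≤ C) :
    gaussProfile (∫ x, f x ∂(gaussianReal 0 1)) ≤
      ∫ x, √(gaussProfile (f x) ^ 2 + f' x ^ 2) ∂(gaussianReal 0 1) := by
  have hc : Continuous f := continuous_iff_continuousAt.2 fun x => (hd x).continuousAt
  set m : ℕ → ℝ → ℝ := fun k u =>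
    sSup ((fun s => |f' (u + s)|) '' Icc (-(1 / ((k : ℝ) + 1))) (1 / ((k : ℝ) + 1))) with hm
  have hη (k : ℕ) : (0 : ℝ) < 1 / ((k : ℝ) + 1) := by positivity
  have hbdd (k : ℕ) (u : ℝ) : BddAbove
      ((fun s => |f' (u + s)|) '' Icc (-(1 / ((k : ℝ) + 1))) (1 / ((k : ℝ) + 1))) :=
    ⟨C, by rintro _ ⟨s, -, rfl⟩; exact hC _⟩
  have hne (k : ℕ) (u : ℝ) :
      ((fun s => |f' (u + s)|) '' Icc (-(1 / ((k : ℝ) + 1))) (1 / ((k : ℝ) + 1))).Nonempty :=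
    ⟨_, 0, ⟨by linarith [hη k], (hη k).le⟩, rfl⟩
  have hle (k : ℕ) (u s : ℝ) (hs : |s| ≤ 1 / ((k : ℝ) + 1)) : |f' (u + s)| ≤ m k u :=
    le_csSup (hbdd k u) ⟨s, abs_le.1 hs, rfl⟩
  have hm0 (k : ℕ) (u : ℝ) : 0 ≤ m k u :=
    (abs_nonneg _).trans (hle k u 0 (by simpa using (hη k).le))
  have hmC (k : ℕ) (u : ℝ) : |m k u| ≤ C := by
    rw [abs_of_nonneg (hm0 k u)]
    refine csSup_le (hne k u) ?_
    rintro _ ⟨s, -, rfl⟩; exact hC _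
  have hmc (k : ℕ) : Continuous (m k) := continuous_sSup_abs_Icc hc' _
  have hlim (u : ℝ) : Tendsto (fun k => m k u) atTop (𝓝 |f' u|) := by
    rw [Metric.tendsto_atTop]
    intro ε hε
    obtain ⟨δ, hδ, h⟩ := Metric.continuous_iff.1 hc'.abs u (ε / 2) (by linarith)
    obtain ⟨K, hK⟩ := exists_nat_one_div_lt hδ
    refine ⟨K, fun k hk => ?_⟩
    have h1 : |f' u| ≤ m k u := by simpa using hle k u 0 (by simpa using (hη k).le)
    have h2 : m k u ≤ |f' u| + ε / 2 := by
      refine csSup_le (hne k u) ?_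
      rintro _ ⟨s, hs, rfl⟩
      have h3 : 1 / ((k : ℝ) + 1) ≤ 1 / ((K : ℝ) + 1) := by
        have : (K : ℝ) ≤ k := by exact_mod_cast hk
        gcongr
      have h4 := h (u + s) (by
        rw [Real.dist_eq, add_sub_cancel_left]
        exact (abs_le.2 hs).trans_lt (h3.trans_lt hK))
      rw [Real.dist_eq] at h4
      linarith [(abs_lt.1 h4).2]
    rw [Real.dist_eq, abs_lt]
    constructor <;> linarith
  have hlim' : Tendsto (fun k => ∫ x, √(gaussProfile (f x) ^ 2 + m k x ^ 2) ∂(gaussianReal 0 1))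
      atTop (𝓝 (∫ x, √(gaussProfile (f x) ^ 2 + f' x ^ 2) ∂(gaussianReal 0 1))) := by
    refine tendsto_integral_of_dominated_convergence (fun _ => 1 + C) (fun k => ?_)
      (integrable_const _) (fun k => Eventually.of_forall fun x => ?_)
      (Eventually.of_forall fun x => ?_)
    · have := hc.gaussProfile_comp hf
      have := hmc k
      exact (Continuous.measurable (by fun_prop)).aestronglyMeasurable
    · exact sqrt_gaussProfile_sq_add_sq_mem (hmC k x)
    · rw [← sq_abs (f' x)]
      exact (Real.continuous_sqrt.tendsto _).comp (((hlim x).pow 2).const_add _)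
  refine ge_of_tendsto' hlim' fun k => ?_
  refine bobkov_gaussianReal_of_slope (hη k) hc hf (hmc k) (hmC k) fun u s hs => ?_
  have h1 := (convex_uIcc u (u + s)).norm_image_sub_le_of_norm_hasDerivWithin_le (f := f) (f' := f')
    (C := m k u) (fun x _ => (hd x).hasDerivWithinAt) (fun x hx => ?_)
    right_mem_uIcc left_mem_uIcc
  · rw [Real.norm_eq_abs, Real.norm_eq_abs, show u - (u + s) = -s by ring, abs_neg] at h1
    linarith
  · have h2 := abs_sub_left_of_mem_uIcc hx
    rw [add_sub_cancel_left] at h2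
    have := hle k u (x - u) (h2.trans hs)
    rwa [add_sub_cancel] at this

instance isProbabilityMeasure_stdGaussian (n : ℕ) : IsProbabilityMeasure (stdGaussian n) := by
  unfold stdGaussian; infer_instance

lemma sqrt_sq_integral_add_sq_integral_le {X : Type*} [MeasurableSpace X] {μ : Measure X}
    {f g : X → ℝ} (hf : Integrable f μ) (hg : Integrable g μ)
    (hfg : Integrable (fun x => √(f x ^ 2 + g x ^ 2)) μ) :
    √((∫ x, f x ∂μ) ^ 2 + (∫ x, g x ∂μ) ^ 2) ≤ ∫ x, √(f x ^ 2 + g x ^ 2) ∂μ := by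
  set a := ∫ x, f x ∂μ
  set b := ∫ x, g x ∂μ
  have hR := Real.sq_sqrt (show 0 ≤ a ^ 2 + b ^ 2 by positivity)
  have hR0 := Real.sqrt_nonneg (a ^ 2 + b ^ 2)
  set R := √(a ^ 2 + b ^ 2)
  have h1 : ∫ x, (a * f x + b * g x) ∂μ = R ^ 2 := by
    rw [integral_add (hf.const_mul a) (hg.const_mul b), integral_const_mul, integral_const_mul, hR]
    ring
  have h2 : ∫ x, (a * f x + b * g x) ∂μ ≤ ∫ x, R * √(f x ^ 2 + g x ^ 2) ∂μ := by
    refine integral_mono ((hf.const_mul a).add (hg.const_mul b)) (hfg.const_mul R) fun x => ?_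
    change a * f x + b * g x ≤ R * √(f x ^ 2 + g x ^ 2)
    rw [← Real.sqrt_mul (by positivity)]
    refine Real.le_sqrt_of_sq_le ?_
    nlinarith [sq_nonneg (a * g x - b * f x)]
  rw [h1, integral_const_mul] at h2
  rcases hR0.eq_or_lt with h | h
  · rw [← h]; exact integral_nonneg fun x => Real.sqrt_nonneg _
  · exact le_of_mul_le_mul_left (by linarith) h

lemma integral_stdGaussian_succ {n : ℕ} {g : (Fin (n + 1) → ℝ) → ℝ}
    (hg : Integrable g (stdGaussian (n + 1))) :
    ∫ x, g x ∂(stdGaussian (n + 1)) =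
      ∫ a, ∫ z, g (Fin.cons a z) ∂(stdGaussian n) ∂(gaussianReal 0 1) := by
  have h := (measurePreserving_piFinSuccAbove (fun _ : Fin (n + 1) => gaussianReal 0 1) 0).symm
  have h1 := h.integral_comp' (g := g)
  change ∫ x, g x ∂(Measure.pi _) = _
  rw [← h1, integral_prod]
  · simp [stdGaussian, MeasurableEquiv.piFinSuccAbove_symm_apply, Fin.insertNthEquiv]
  · exact (h.integrable_comp_emb (MeasurableEquiv.measurableEmbedding _)).2 hg

/-- Bobkov's functional inequality for the standard Gaussian measure. -/
lemma bobkov_stdGaussian {n : ℕ} {f : (Fin n → ℝ) → ℝ} {f' : Fin n → (Fin n → ℝ) → ℝ} {C : ℝ}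
    (hc : Continuous f) (hf : ∀ x, f x ∈ Ioo (0 : ℝ) 1)
    (hd : ∀ i x, HasDerivAt (fun u => f (Function.update x i u)) (f' i x) (x i))
    (hc' : ∀ i, Continuous (f' i)) (hC : ∀ i x, |f' i x| ≤ C) :
    gaussProfile (∫ x, f x ∂(stdGaussian n)) ≤
      ∫ x, √(gaussProfile (f x) ^ 2 + ∑ i, f' i x ^ 2) ∂(stdGaussian n) := by
  induction n with
  | zero =>
    rw [stdGaussian, Measure.pi_of_empty]
    simp [Real.sqrt_sq (gaussProfile_pos _).le]
  | succ n ih =>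
    have hf1 : ∀ x, |f x| ≤ 1 := fun x => by rw [abs_of_pos (hf x).1]; exact (hf x).2.le
    have hgc := hc.gaussProfile_comp hf
    have hC0 : 0 ≤ C := (abs_nonneg _).trans (hC 0 0)
    have hSle (x) : √(gaussProfile (f x) ^ 2 + ∑ i, f' i x ^ 2) ≤ 1 + (n + 1) * C := by
      rw [Real.sqrt_le_left (by positivity)]
      have h1 : ∑ i, f' i x ^ 2 ≤ ∑ i : Fin (n + 1), C ^ 2 :=
        Finset.sum_le_sum fun i _ => by
          rw [← sq_abs]; exact pow_le_pow_left₀ (abs_nonneg _) (hC i x) 2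
      rw [Finset.sum_const, Finset.card_univ, Fintype.card_fin, nsmul_eq_mul] at h1
      push_cast at h1
      have h2 := gaussProfile_le_one (f x)
      have h3 := (gaussProfile_pos (f x)).le
      have h4 : (0 : ℝ) ≤ n := by positivity
      nlinarith [mul_nonneg (mul_nonneg h4 (by positivity : (0 : ℝ) ≤ n + 1)) (sq_nonneg C),
        mul_nonneg h4 hC0]
    have hSc : Continuous fun x => √(gaussProfile (f x) ^ 2 + ∑ i, f' i x ^ 2) := by fun_prop
    have hcons (a : ℝ) : Continuous fun z : Fin n → ℝ => (Fin.cons a z : Fin (n + 1) → ℝ) := by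
      fun_prop
    have hcons' (z : Fin n → ℝ) : Continuous fun a : ℝ => (Fin.cons a z : Fin (n + 1) → ℝ) := by
      fun_prop
    have hi (μ : Measure (Fin n → ℝ)) [IsProbabilityMeasure μ] (g : (Fin (n + 1) → ℝ) → ℝ) (D : ℝ)
        (hg : Continuous g) (hD : ∀ x, |g x| ≤ D) (a : ℝ) :
        Integrable (fun z => g (Fin.cons a z)) μ :=
      integrable_of_continuous_of_abs_le (hg.comp (hcons a)) fun z => hD _
    have hic (g : (Fin (n + 1) → ℝ) → ℝ) (D : ℝ) (hg : Continuous g) (hD : ∀ x, |g x| ≤ D) :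
        Continuous fun a => ∫ z, g (Fin.cons a z) ∂(stdGaussian n) :=
      continuous_of_dominated (fun a => (hi _ g D hg hD a).aestronglyMeasurable)
        (fun a => Eventually.of_forall fun z => hD _) (integrable_const D)
        (Eventually.of_forall fun z => hg.comp (hcons' z))
    set F : ℝ → ℝ := fun a => ∫ z, f (Fin.cons a z) ∂(stdGaussian n) with hF
    set F' : ℝ → ℝ := fun a => ∫ z, f' 0 (Fin.cons a z) ∂(stdGaussian n) with hF'
    have hFd (a : ℝ) : HasDerivAt F (F' a) a := by
      refine (hasDerivAt_integral_of_dominated_loc_of_deriv_le (bound := fun _ => C)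
        (F' := fun a z => f' 0 (Fin.cons a z)) (s := univ) univ_mem
        (Eventually.of_forall fun a => (hi _ f 1 hc hf1 a).aestronglyMeasurable)
        (hi _ f 1 hc hf1 a) (hi _ _ C (hc' 0) (hC 0) a).aestronglyMeasurable
        (Eventually.of_forall fun z b _ => hC 0 _) (integrable_const _)
        (Eventually.of_forall fun z b _ => ?_)).2
      simpa using hd 0 (Fin.cons b z)
    have hF01 (a : ℝ) : F a ∈ Ioo (0 : ℝ) 1 :=
      integral_mem_Ioo_of_continuous (hc.comp (hcons a)) fun z => hf _
    have hF'C (a : ℝ) : |F' a| ≤ C := by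
      have := norm_integral_le_of_norm_le_const (μ := stdGaussian n) (C := C)
        (f := fun z => f' 0 (Fin.cons a z)) (Eventually.of_forall fun z => hC 0 (Fin.cons a z))
      simpa using this
    have h1 := bobkov_gaussianReal hF01 hFd (hic _ C (hc' 0) (hC 0)) hF'C
    rw [integral_stdGaussian_succ (integrable_of_continuous_of_abs_le hc hf1),
      integral_stdGaussian_succ (integrable_of_continuous_of_abs_le hSc fun x => by
        rw [abs_of_nonneg (Real.sqrt_nonneg _)]; exact hSle x)]
    refine h1.trans (integral_mono ?_ ?_ fun a => ?_)
    · have := (hic _ C (hc' 0) (hC 0))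
      have h3 : Continuous F := hic _ 1 hc hf1
      have h4 := h3.gaussProfile_comp hF01
      exact integrable_of_continuous_of_abs_le (by fun_prop)
        fun a => sqrt_gaussProfile_sq_add_sq_mem (hF'C a)
    · refine integrable_of_continuous_of_abs_le (hic _ (1 + (n + 1) * C) hSc fun x => by
        rw [abs_of_nonneg (Real.sqrt_nonneg _)]; exact hSle x) (C := 1 + (n + 1) * C) fun a => ?_
      rw [abs_of_nonneg (integral_nonneg fun z => Real.sqrt_nonneg _)]
      refine (integral_mono (hi _ _ (1 + (n + 1) * C) hSc (fun x => by
        rw [abs_of_nonneg (Real.sqrt_nonneg _)]; exact hSle x) a) (integrable_const _)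
        fun z => hSle _).trans_eq ?_
      simp
    · set A : (Fin n → ℝ) → ℝ := fun z => √(gaussProfile (f (Fin.cons a z)) ^ 2 +
        ∑ i : Fin n, f' i.succ (Fin.cons a z) ^ 2) with hA
      have hA2 (z) : A z ^ 2 = gaussProfile (f (Fin.cons a z)) ^ 2 +
          ∑ i : Fin n, f' i.succ (Fin.cons a z) ^ 2 := Real.sq_sqrt (by positivity)
      have hS (z) : √(gaussProfile (f (Fin.cons a z)) ^ 2 + ∑ i, f' i (Fin.cons a z) ^ 2) =
          √(A z ^ 2 + f' 0 (Fin.cons a z) ^ 2) := by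
        rw [hA2, Fin.sum_univ_succ]
        congr 1
        ring
      have hAS (z) : |A z| ≤ 1 + (n + 1) * C := by
        refine le_trans ?_ (hSle (Fin.cons a z))
        rw [hS]
        exact Real.abs_le_sqrt (by linarith [sq_nonneg (f' 0 (Fin.cons a z))])
      have hAc : Continuous A := by
        have := hcons a
        exact (Real.continuous_sqrt.comp (g := fun x => √x) (f := fun x => gaussProfile (f x) ^ 2 +
          ∑ i : Fin n, f' i.succ x ^ 2) (by fun_prop)).comp this
      have h2 : gaussProfile (F a) ≤ ∫ z, A z ∂(stdGaussian n) := by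
        refine ih (f' := fun i z => f' i.succ (Fin.cons a z)) (hc.comp (hcons a))
          (fun z => hf _) (fun i z => ?_) (fun i => (hc' _).comp (hcons a)) (fun i z => hC _ _)
        simpa [Fin.cons_update] using hd i.succ (Fin.cons a z)
      simp only [hS]
      refine le_trans ?_ (sqrt_sq_integral_add_sq_integral_le
        (integrable_of_continuous_of_abs_le hAc hAS) (hi _ _ C (hc' 0) (hC 0) a) ?_)
      · refine Real.sqrt_le_sqrt (add_le_add_left ?_ _)
        exact pow_le_pow_left₀ (gaussProfile_pos _).le h2 2
      · simp only [← hS]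
        exact hi _ _ (1 + (n + 1) * C) hSc (fun x => by
          rw [abs_of_nonneg (Real.sqrt_nonneg _)]; exact hSle x) a

/-- Density at `y` of the standard Gaussian measure translated by `c`, relative to the standard
Gaussian measure. -/
noncomputable def cameronMartin {n : ℕ} (c y : Fin n → ℝ) : ℝ :=
  Real.exp (∑ i, (c i * y i - c i ^ 2 / 2))

lemma cameronMartin_nonneg {n : ℕ} (c y : Fin n → ℝ) : 0 ≤ cameronMartin c y := (Real.exp_pos _).le

lemma gaussianReal_eq_withDensity (c : ℝ) : gaussianReal c 1 =
    (gaussianReal 0 1).withDensity fun y => ENNReal.ofReal (Real.exp (c * y - c ^ 2 / 2)) := by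
  rw [gaussianReal_of_var_ne_zero _ one_ne_zero, gaussianReal_of_var_ne_zero _ one_ne_zero,
    ← withDensity_mul _ (measurable_gaussianPDF 0 1)
      (Measurable.ennreal_ofReal (Continuous.measurable (by fun_prop)))]
  congr 1
  funext y
  rw [Pi.mul_apply, gaussianPDF, gaussianPDF, ← ENNReal.ofReal_mul (gaussianPDFReal_nonneg _ _ _)]
  congr 1
  rw [gaussianPDFReal, gaussianPDFReal, mul_assoc _ (Real.exp _) (Real.exp _), ← Real.exp_add]
  congr 2
  push_cast
  ring

lemma map_add_stdGaussian {n : ℕ} (c : Fin n → ℝ) :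
    (stdGaussian n).map (fun y => y + c) =
      (stdGaussian n).withDensity fun y => ENNReal.ofReal (cameronMartin c y) := by
  have hg (i : Fin n) : Measurable fun x : ℝ => ENNReal.ofReal (Real.exp (c i * x - c i ^ 2 / 2)) :=
    Measurable.ennreal_ofReal (Continuous.measurable (by fun_prop))
  have h1 : (stdGaussian n).map (fun y => y + c) = Measure.pi fun i => gaussianReal (c i) 1 := by
    have := Measure.pi_map_pi (μ := fun _ : Fin n => gaussianReal 0 1) (f := fun i x => x + c i)
      (fun i => by fun_prop)
    simp only [gaussianReal_map_add_const, zero_add] at this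
    exact this
  rw [h1]
  refine Measure.pi_eq fun s hs => ?_
  have h2 : (univ.pi s).indicator (fun y => ENNReal.ofReal (cameronMartin c y)) = fun y =>
      ∏ i, (s i).indicator (fun x => ENNReal.ofReal (Real.exp (c i * x - c i ^ 2 / 2))) (y i) := by
    funext y
    by_cases hy : y ∈ univ.pi s
    · rw [indicator_of_mem hy, cameronMartin, Real.exp_sum,
        ENNReal.ofReal_prod_of_nonneg fun _ _ => (Real.exp_pos _).le]
      refine Finset.prod_congr rfl fun i _ => ?_
      rw [indicator_of_mem (hy i (mem_univ i))]
    · rw [indicator_of_notMem hy]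
      simp only [mem_univ_pi, not_forall] at hy
      obtain ⟨i, hi⟩ := hy
      exact (Finset.prod_eq_zero (Finset.mem_univ i) (indicator_of_notMem hi _)).symm
  rw [withDensity_apply _ (MeasurableSet.univ_pi hs), ← lintegral_indicator (MeasurableSet.univ_pi hs),
    h2, stdGaussian, lintegral_prod_eq_prod_lintegral_of_indepFun _ _
      (iIndepFun_pi fun i => ((hg i).indicator (hs i)).aemeasurable)
      fun i => ((hg i).indicator (hs i)).comp (measurable_pi_apply i)]
  refine Finset.prod_congr rfl fun i _ => ?_
  rw [gaussianReal_eq_withDensity (c i), withDensity_apply _ (hs i), ← lintegral_indicator (hs i),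
    ← (measurePreserving_eval (fun _ : Fin n => gaussianReal 0 1) i).lintegral_comp
      ((hg i).indicator (hs i))]

lemma continuous_cameronMartin {n : ℕ} (c : Fin n → ℝ) : Continuous (cameronMartin c) := by
  unfold cameronMartin; fun_prop

lemma integral_add_stdGaussian {n : ℕ} (c : Fin n → ℝ) {g : (Fin n → ℝ) → ℝ} (hg : Measurable g) :
    ∫ y, g (y + c) ∂(stdGaussian n) = ∫ y, cameronMartin c y * g y ∂(stdGaussian n) := by
  rw [← integral_map (φ := fun y => y + c) (f := g) (by fun_prop) hg.aestronglyMeasurable,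
    map_add_stdGaussian, integral_withDensity_eq_integral_toReal_smul
      ((continuous_cameronMartin c).measurable.ennreal_ofReal)
      (Eventually.of_forall fun _ => ENNReal.ofReal_lt_top)]
  refine integral_congr_ae (Eventually.of_forall fun y => ?_)
  simp only [smul_eq_mul]
  rw [ENNReal.toReal_ofReal (cameronMartin_nonneg c y)]

lemma integrable_exp_mul_sum_abs {n : ℕ} (a : ℝ) :
    Integrable (fun y : Fin n → ℝ => Real.exp (a * ∑ i, |y i|)) (stdGaussian n) := by
  have h : Integrable (fun x : ℝ => Real.exp (a * |x|)) (gaussianReal 0 1) :=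
    integrable_exp_mul_abs (X := fun x => x) (integrable_exp_mul_gaussianReal a)
      (integrable_exp_mul_gaussianReal (-a))
  have := Integrable.fintype_prod (μ := fun _ : Fin n => gaussianReal 0 1)
    (f := fun _ x => Real.exp (a * |x|)) fun _ => h
  simp only [← Real.exp_sum, ← Finset.mul_sum] at this
  exact this

lemma cameronMartin_le {n : ℕ} {c : Fin n → ℝ} {R : ℝ} (hc : ∀ i, |c i| ≤ R) (y : Fin n → ℝ) :
    cameronMartin c y ≤ Real.exp (R * ∑ i, |y i|) := by
  refine Real.exp_le_exp.2 ?_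
  rw [Finset.mul_sum]
  refine Finset.sum_le_sum fun i _ => ?_
  have h1 : c i * y i ≤ |c i| * |y i| := by rw [← abs_mul]; exact le_abs_self _
  nlinarith [mul_le_mul_of_nonneg_right (hc i) (abs_nonneg (y i)), sq_nonneg (c i)]

lemma abs_sub_mul_cameronMartin_mul_le {n : ℕ} {c : Fin n → ℝ} {R : ℝ} (hc : ∀ i, |c i| ≤ R)
    {g : (Fin n → ℝ) → ℝ} (hg : ∀ y, |g y| ≤ 1) (i : Fin n) (y : Fin n → ℝ) :
    |(y i - c i) * (cameronMartin c y * g y)| ≤ Real.exp R * Real.exp ((R + 1) * ∑ i, |y i|) := by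
  have h1 : |y i - c i| ≤ Real.exp (R + ∑ i, |y i|) := by
    have h2 : |y i| ≤ ∑ i, |y i| :=
      Finset.single_le_sum (f := fun i => |y i|) (fun i _ => abs_nonneg _) (Finset.mem_univ i)
    have h3 := Real.add_one_le_exp (R + ∑ i, |y i|)
    linarith [abs_sub (y i) (c i), hc i]
  have h4 : |cameronMartin c y * g y| ≤ Real.exp (R * ∑ i, |y i|) := by
    rw [abs_mul, abs_of_nonneg (cameronMartin_nonneg c y)]
    have := mul_le_mul (cameronMartin_le hc y) (hg y) (abs_nonneg _) (Real.exp_pos _).le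
    linarith
  rw [abs_mul]
  refine (mul_le_mul h1 h4 (abs_nonneg _) (Real.exp_pos _).le).trans_eq ?_
  rw [← Real.exp_add, ← Real.exp_add]
  congr 1
  ring

lemma integral_apply_mul_add_stdGaussian {n : ℕ} (c : Fin n → ℝ) {g : (Fin n → ℝ) → ℝ}
    (hg : Measurable g) (i : Fin n) :
    ∫ y, y i * g (y + c) ∂(stdGaussian n) =
      ∫ y, (y i - c i) * (cameronMartin c y * g y) ∂(stdGaussian n) := by
  have h := integral_add_stdGaussian c (g := fun y => (y i - c i) * g y)
    (((measurable_pi_apply i).sub_const _).mul hg)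
  simp only [Pi.add_apply, add_sub_cancel_right] at h
  rw [h]
  congr 1
  funext y
  ring

lemma continuous_cameronMartin_left {n : ℕ} (y : Fin n → ℝ) :
    Continuous fun c => cameronMartin c y := by
  unfold cameronMartin; fun_prop

lemma abs_apply_le_of_mem_ball {n : ℕ} {c c₀ : Fin n → ℝ} (hc : c ∈ Metric.ball c₀ 1) (i : Fin n) :
    |c i| ≤ ‖c₀‖ + 1 := by
  have h1 := norm_le_pi_norm c i
  have h2 := mem_ball_iff_norm.1 hc
  have h3 := norm_sub_norm_le c c₀
  rw [Real.norm_eq_abs] at h1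
  linarith

lemma continuous_integral_apply_mul_add {n : ℕ} {g : (Fin n → ℝ) → ℝ} (hg : Measurable g)
    (hb : ∀ y, |g y| ≤ 1) (i : Fin n) :
    Continuous fun c => ∫ y, y i * g (y + c) ∂(stdGaussian n) := by
  simp only [integral_apply_mul_add_stdGaussian _ hg]
  refine continuous_iff_continuousAt.2 fun c₀ => ?_
  refine continuousAt_of_dominated (Eventually.of_forall fun c => ?_)
    (bound := fun y => Real.exp (‖c₀‖ + 1) * Real.exp (((‖c₀‖ + 1) + 1) * ∑ i, |y i|)) ?_
    ((integrable_exp_mul_sum_abs _).const_mul _) (Eventually.of_forall fun y => ?_)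
  · have := (continuous_cameronMartin c).measurable
    exact (Measurable.mul (by fun_prop) (by fun_prop)).aestronglyMeasurable
  · filter_upwards [Metric.ball_mem_nhds c₀ one_pos] with c hc
    exact Eventually.of_forall fun y =>
      abs_sub_mul_cameronMartin_mul_le (abs_apply_le_of_mem_ball hc) hb i y
  · have := continuous_cameronMartin_left y
    exact Continuous.continuousAt (by fun_prop)

lemma continuous_integral_add {n : ℕ} {g : (Fin n → ℝ) → ℝ} (hg : Measurable g)
    (hb : ∀ y, |g y| ≤ 1) : Continuous fun c => ∫ y, g (y + c) ∂(stdGaussian n) := by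
  simp only [integral_add_stdGaussian _ hg]
  refine continuous_iff_continuousAt.2 fun c₀ => ?_
  refine continuousAt_of_dominated (Eventually.of_forall fun c => ?_)
    (bound := fun y => Real.exp ((‖c₀‖ + 1) * ∑ i, |y i|)) ?_
    (integrable_exp_mul_sum_abs _) (Eventually.of_forall fun y => ?_)
  · have := (continuous_cameronMartin c).measurable
    exact (Measurable.mul (by fun_prop) (by fun_prop)).aestronglyMeasurable
  · filter_upwards [Metric.ball_mem_nhds c₀ one_pos] with c hc
    refine Eventually.of_forall fun y => ?_
    rw [Real.norm_eq_abs, abs_mul, abs_of_nonneg (cameronMartin_nonneg c y)]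
    have := mul_le_mul (cameronMartin_le (abs_apply_le_of_mem_ball hc) y) (hb y) (abs_nonneg _)
      (Real.exp_pos _).le
    linarith
  · have := continuous_cameronMartin_left y
    exact Continuous.continuousAt (by fun_prop)

lemma hasDerivAt_cameronMartin_update {n : ℕ} (c y : Fin n → ℝ) (i : Fin n) (u : ℝ) :
    HasDerivAt (fun u => cameronMartin (Function.update c i u) y)
      ((y i - u) * cameronMartin (Function.update c i u) y) u := by
  have h (j : Fin n) : HasDerivAt
      (fun u => Function.update c i u j * y j - Function.update c i u j ^ 2 / 2)
      ((Pi.single i 1 : Fin n → ℝ) j * (y j - Function.update c i u j)) u := by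
    have h1 := hasDerivAt_pi.1 (hasDerivAt_update c i u) j
    convert! (h1.mul_const (y j)).sub ((h1.pow 2).div_const 2) using 1
    ring
  convert! (HasDerivAt.fun_sum fun j (_ : j ∈ Finset.univ) => h j).exp using 1
  rw [cameronMartin, mul_comm]
  congr 1
  simp [Pi.single_apply]

lemma hasDerivAt_integral_add_update {n : ℕ} {g : (Fin n → ℝ) → ℝ} (hg : Measurable g)
    (hb : ∀ y, |g y| ≤ 1) (i : Fin n) (c : Fin n → ℝ) :
    HasDerivAt (fun u => ∫ y, g (y + Function.update c i u) ∂(stdGaussian n))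
      (∫ y, y i * g (y + c) ∂(stdGaussian n)) (c i) := by
  rw [integral_apply_mul_add_stdGaussian _ hg]
  simp only [integral_add_stdGaussian _ hg]
  have hm (c : Fin n → ℝ) : AEStronglyMeasurable (fun y => cameronMartin c y * g y)
      (stdGaussian n) := by
    have := (continuous_cameronMartin c).measurable
    exact (Measurable.mul (by fun_prop) (by fun_prop)).aestronglyMeasurable
  have h := hasDerivAt_integral_of_dominated_loc_of_deriv_le (μ := stdGaussian n)
    (F := fun u y => cameronMartin (Function.update c i u) y * g y)
    (F' := fun u y => (y i - Function.update c i u i) *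
      (cameronMartin (Function.update c i u) y * g y)) (x₀ := c i)
    (bound := fun y => Real.exp (‖c‖ + 1) * Real.exp (((‖c‖ + 1) + 1) * ∑ i, |y i|))
    (Metric.ball_mem_nhds (c i) one_pos) (Eventually.of_forall fun u => hm _) ?_ ?_
    (Eventually.of_forall fun y u hu => ?_) ((integrable_exp_mul_sum_abs _).const_mul _)
    (Eventually.of_forall fun y u hu => ?_)
  · simpa using h.2
  · refine (integrable_exp_mul_sum_abs ‖c‖).mono' (hm _) (Eventually.of_forall fun y => ?_)
    rw [Function.update_eq_self]
    rw [Real.norm_eq_abs, abs_mul, abs_of_nonneg (cameronMartin_nonneg c y)]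
    have := mul_le_mul (cameronMartin_le (fun i => norm_le_pi_norm c i) y) (hb y) (abs_nonneg _)
      (Real.exp_pos _).le
    linarith
  · exact ((measurable_pi_apply i).sub_const _).aestronglyMeasurable.mul (hm _)
  · refine abs_sub_mul_cameronMartin_mul_le (abs_apply_le_of_mem_ball ?_) hb i y
    rw [mem_ball_iff_norm, pi_norm_lt_iff one_pos]
    intro j
    rcases eq_or_ne j i with rfl | hj
    · simpa using mem_ball_iff_norm.1 hu
    · simp [hj]
  · simpa [mul_assoc] using (hasDerivAt_cameronMartin_update c y i u).mul_const (g y)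

lemma tendsto_gaussPhi_atTop : Tendsto gaussPhi atTop (𝓝 0) := by
  have h : Tendsto (fun x : ℝ => -(x ^ 2) / 2) atTop atBot := by
    have := ((tendsto_pow_atTop (α := ℝ) two_ne_zero).atTop_div_const
      (show (0 : ℝ) < 2 by norm_num))
    convert! tendsto_neg_atTop_atBot.comp this using 1
    funext x
    simp [neg_div]
  have := (Real.tendsto_exp_atBot.comp h).const_mul (√(2 * π))⁻¹
  rw [mul_zero] at this
  exact this

lemma integral_posPart_sub_gaussianReal (q : ℝ) :
    ∫ x, max (x - q) 0 ∂(gaussianReal 0 1) = gaussPhi q - q * gaussCdf (-q) := by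
  rw [integral_gaussianReal_eq_integral_smul one_ne_zero]
  have h1 : (fun x => gaussianPDFReal 0 1 x • max (x - q) 0) =
      (Ioi q).indicator fun x => (x - q) * gaussPhi x := by
    funext x
    rw [← gaussPhi_eq_gaussianPDFReal, smul_eq_mul]
    by_cases hx : x ∈ Ioi q
    · rw [indicator_of_mem hx, max_eq_left (sub_nonneg.2 (le_of_lt hx)), mul_comm]
    · rw [indicator_of_notMem hx, max_eq_right (sub_nonpos.2 (not_lt.1 hx)), mul_zero]
  rw [h1, integral_indicator measurableSet_Ioi]
  have hd (x : ℝ) :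
      HasDerivAt (fun x => -gaussPhi x - q * gaussCdf x) ((x - q) * gaussPhi x) x := by
    convert! (hasDerivAt_gaussPhi x).neg.sub ((hasDerivAt_gaussCdf x).const_mul q) using 1
    ring
  rw [integral_Ioi_of_hasDerivAt_of_nonneg' (fun x _ => hd x)
    (fun x hx => mul_nonneg (sub_nonneg.2 (le_of_lt hx)) (gaussPhi_pos x).le)
    (tendsto_gaussPhi_atTop.neg.sub (tendsto_gaussCdf_atTop.const_mul q)), gaussCdf_neg]
  ring

lemma map_sum_mul_stdGaussian {n : ℕ} {e : Fin n → ℝ} (he : ∑ i, e i ^ 2 = 1) :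
    (stdGaussian n).map (fun y => ∑ i, e i * y i) = gaussianReal 0 1 := by
  have hm : Measurable fun y : Fin n → ℝ => ∑ i, e i * y i := by fun_prop
  have := Measure.isProbabilityMeasure_map (μ := stdGaussian n) hm.aemeasurable
  refine Measure.ext_of_charFun ?_
  funext t
  rw [charFun_apply_real, integral_map hm.aemeasurable
    (Continuous.measurable (by fun_prop)).aestronglyMeasurable, charFun_gaussianReal]
  have h1 (y : Fin n → ℝ) : Complex.exp (t * (∑ i, e i * y i : ℝ) * Complex.I) =
      ∏ i, Complex.exp ((t * e i : ℝ) * y i * Complex.I) := by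
    rw [← Complex.exp_sum]
    congr 1
    push_cast
    rw [Finset.mul_sum, Finset.sum_mul]
    refine Finset.sum_congr rfl fun i _ => ?_
    ring
  simp only [h1]
  rw [stdGaussian, integral_fintype_prod_eq_prod (𝕜 := ℂ)
    (f := fun i (x : ℝ) => Complex.exp ((t * e i : ℝ) * x * Complex.I))]
  simp only [← charFun_apply_real, charFun_gaussianReal]
  rw [← Complex.exp_sum]
  congr 1
  have h2 : (∑ i, (e i : ℂ) ^ 2) = 1 := by exact_mod_cast he
  have h3 : ∀ i, (((t * e i : ℝ) : ℂ) * (0 : ℝ) * Complex.I -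
      ((1 : ℝ≥0) : ℝ) * ((t * e i : ℝ) : ℂ) ^ 2 / 2) = -(t ^ 2 / 2) * (e i : ℂ) ^ 2 := by
    intro i; push_cast; ring
  simp only [h3, ← Finset.mul_sum, h2]
  push_cast
  ring

lemma integrable_apply_stdGaussian {n : ℕ} (i : Fin n) :
    Integrable (fun y => y i) (stdGaussian n) := by
  have h : Integrable (fun x : ℝ => x) (gaussianReal 0 1) :=
    memLp_one_iff_integrable.1 (memLp_id_gaussianReal 1)
  exact (measurePreserving_eval (fun _ : Fin n => gaussianReal 0 1) i).integrable_comp_of_integrable h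

/-- Among functions with values in `[0, 1]` and a given Gaussian mean, the first moment is largest
for indicators of half-spaces. -/
lemma sum_sq_integral_apply_mul_le {n : ℕ} {g : (Fin n → ℝ) → ℝ} (hg : Measurable g)
    (h01 : ∀ y, g y ∈ Icc (0 : ℝ) 1) (hi : ∫ y, g y ∂(stdGaussian n) ∈ Ioo (0 : ℝ) 1) :
    ∑ i, (∫ y, y i * g y ∂(stdGaussian n)) ^ 2 ≤ gaussProfile (∫ y, g y ∂(stdGaussian n)) ^ 2 := by
  set v : Fin n → ℝ := fun i => ∫ y, y i * g y ∂(stdGaussian n) with hv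
  set a := ∫ y, g y ∂(stdGaussian n) with ha
  change ∑ i, v i ^ 2 ≤ _
  have hr := Real.sq_sqrt (show 0 ≤ ∑ i, v i ^ 2 by positivity)
  have hr0 := Real.sqrt_nonneg (∑ i, v i ^ 2)
  set r := √(∑ i, v i ^ 2)
  rw [← hr]
  refine pow_le_pow_left₀ hr0 ?_ 2
  rcases hr0.eq_or_lt with h | h
  · rw [← h]; exact (gaussProfile_pos _).le
  have hb (y : Fin n → ℝ) : ‖g y‖ ≤ 1 := by
    rw [Real.norm_eq_abs, abs_of_nonneg (h01 y).1]; exact (h01 y).2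
  have hgi : Integrable g (stdGaussian n) :=
    Integrable.of_bound hg.aestronglyMeasurable 1 (Eventually.of_forall hb)
  have hyi (i : Fin n) : Integrable (fun y => y i * g y) (stdGaussian n) :=
    (integrable_apply_stdGaussian i).mul_bdd hg.aestronglyMeasurable (Eventually.of_forall hb)
  have he : ∑ i, (v i / r) ^ 2 = 1 := by
    simp only [div_pow, ← Finset.sum_div, hr]
    rw [← hr]
    field_simp
  set L : (Fin n → ℝ) → ℝ := fun y => ∑ i, v i / r * y i with hL
  have hLm : Measurable L := by fun_prop
  have hLi : Integrable L (stdGaussian n) :=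
    integrable_finsetSum _ fun i _ => (integrable_apply_stdGaussian i).const_mul _
  have hLg : Integrable (fun y => L y * g y) (stdGaussian n) :=
    hLi.mul_bdd hg.aestronglyMeasurable (Eventually.of_forall hb)
  have h1 : ∫ y, L y * g y ∂(stdGaussian n) = r := by
    simp only [hL, Finset.sum_mul, mul_assoc]
    rw [integral_finsetSum _ fun i _ => (hyi i).const_mul _]
    simp only [integral_const_mul]
    change ∑ i, v i / r * v i = r
    have : ∀ i, v i / r * v i = v i ^ 2 / r := fun i => by ring
    simp only [this, ← Finset.sum_div, ← hr]
    field_simp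
  set q := -gaussCdfInv a with hq
  have h2 : ∫ y, max (L y - q) 0 ∂(stdGaussian n) = gaussPhi q - q * gaussCdf (-q) := by
    rw [← integral_posPart_sub_gaussianReal, ← map_sum_mul_stdGaussian he,
      integral_map hLm.aemeasurable (Continuous.measurable (by fun_prop)).aestronglyMeasurable]
  have h3 : ∫ y, (L y * g y - q * g y) ∂(stdGaussian n) ≤ ∫ y, max (L y - q) 0 ∂(stdGaussian n) := by
    refine integral_mono (hLg.sub (hgi.const_mul q)) (hLi.sub (integrable_const q)).pos_part
      fun y => ?_
    change L y * g y - q * g y ≤ max (L y - q) 0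
    rw [← sub_mul]
    have h4 := (h01 y).1
    have h5 := (h01 y).2
    rcases le_total (L y - q) 0 with h6 | h6
    · exact (mul_nonpos_of_nonpos_of_nonneg h6 h4).trans (le_max_right _ _)
    · exact (mul_le_of_le_one_right h6 h5).trans (le_max_left _ _)
  rw [integral_sub hLg (hgi.const_mul q), integral_const_mul, h1, h2, ← ha, hq, neg_neg,
    gaussCdf_gaussCdfInv hi, gaussPhi_neg] at h3
  have : gaussProfile a = gaussPhi (gaussCdfInv a) := rfl
  linarith

section OrnsteinUhlenbeck

variable {n : ℕ} {f : (Fin n → ℝ) → ℝ} {t : ℝ}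

lemma sqrt_one_sub_exp_pos (ht : 0 < t) : 0 < √(1 - Real.exp (-2 * t)) :=
  Real.sqrt_pos.2 (sub_pos.2 (Real.exp_lt_one_iff.2 (by linarith)))

lemma OU_eq_integral_add (ht : 0 < t) (f : (Fin n → ℝ) → ℝ) (x : Fin n → ℝ) :
    OU n t f x = ∫ y, f (√(1 - Real.exp (-2 * t)) •
      (y + (Real.exp (-t) / √(1 - Real.exp (-2 * t))) • x)) ∂(stdGaussian n) := by
  have hs := (sqrt_one_sub_exp_pos ht).ne'
  unfold OU
  generalize √(1 - Real.exp (-2 * t)) = s at hs ⊢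
  congr 1
  funext y
  congr 1
  funext i
  simp only [Pi.smul_apply, Pi.add_apply, smul_eq_mul]
  field_simp
  ring

/-- Smoothness of the Ornstein-Uhlenbeck semigroup, with a bound on the gradient. -/
lemma exists_partialDeriv_OU (ht : 0 < t) (hm : Measurable f) {η : ℝ} (hη : 0 < η)
    (hf : ∀ x, f x ∈ Icc η (1 - η)) :
    Continuous (OU n t f) ∧ (∀ x, OU n t f x ∈ Icc η (1 - η)) ∧
    ∃ F' : Fin n → (Fin n → ℝ) → ℝ,
      (∀ i x, HasDerivAt (fun u => OU n t f (Function.update x i u)) (F' i x) (x i)) ∧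
      (∀ i, Continuous (F' i)) ∧
      ∀ x, ∑ i, F' i x ^ 2 ≤
        ((Real.exp (-t) / √(1 - Real.exp (-2 * t))) * gaussProfile (OU n t f x)) ^ 2 := by
  set s := √(1 - Real.exp (-2 * t)) with hs
  set k := Real.exp (-t) / s with hk
  set g : (Fin n → ℝ) → ℝ := fun y => f (s • y) with hg
  have hgm : Measurable g := hm.comp (measurable_const_smul s)
  have hgb (y) : |g y| ≤ 1 := by
    have := hf (s • y)
    rw [abs_le]; constructor <;> linarith [this.1, this.2]
  have hOU (x) : OU n t f x = ∫ y, g (y + k • x) ∂(stdGaussian n) := OU_eq_integral_add ht f x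
  have hInt (c : Fin n → ℝ) : Integrable (fun y => g (y + c)) (stdGaussian n) :=
    Integrable.of_bound (hgm.comp (measurable_add_const c)).aestronglyMeasurable 1
      (Eventually.of_forall fun y => hgb _)
  have hOU01 (x) : OU n t f x ∈ Icc η (1 - η) := by
    rw [hOU]
    constructor
    · have := integral_mono (integrable_const η) (hInt (k • x)) fun y => (hf _).1
      simpa using this
    · have := integral_mono (hInt (k • x)) (integrable_const (1 - η)) fun y => (hf _).2
      simpa using this
  refine ⟨?_, hOU01, fun i x => k * ∫ y, y i * g (y + k • x) ∂(stdGaussian n),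
    fun i x => ?_, fun i => ?_, fun x => ?_⟩
  · simp only [funext hOU]
    exact (continuous_integral_add hgm hgb).comp (continuous_const_smul k)
  · simp only [hOU]
    have h1 := hasDerivAt_integral_add_update hgm hgb i (k • x)
    have h2 : HasDerivAt (fun u : ℝ => k * u) k (x i) := by
      simpa using (hasDerivAt_id (x i)).const_mul k
    have h3 := HasDerivAt.comp (x i) (h₂ := fun u =>
      ∫ y, g (y + Function.update (k • x) i u) ∂(stdGaussian n)) (h := fun u => k * u) h1 h2
    convert! h3 using 1
    · funext u
      simp only [Function.comp]
      congr 1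
      funext y
      rw [← smul_eq_mul, Function.update_smul]
    · ring
  · exact continuous_const.mul
      ((continuous_integral_apply_mul_add hgm hgb i).comp (continuous_const_smul k))
  · simp only [mul_pow, ← Finset.mul_sum, hOU]
    refine mul_le_mul_of_nonneg_left ?_ (sq_nonneg k)
    refine sum_sq_integral_apply_mul_le (g := fun y => g (y + k • x))
      (hgm.comp (measurable_add_const _)) (fun y => ?_) ?_
    · have := hf (s • (y + k • x))
      exact ⟨hη.le.trans this.1, this.2.trans (by linarith)⟩
    · have := hOU01 x
      rw [hOU] at this
      exact ⟨hη.trans_le this.1, this.2.trans_lt (by linarith)⟩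

end OrnsteinUhlenbeck

section Concentration

variable {n : ℕ} {F : (Fin n → ℝ) → ℝ} {F' : Fin n → (Fin n → ℝ) → ℝ} {k : ℝ}

lemma continuous_gaussCdfInv_comp (hc : Continuous F) (hF : ∀ x, F x ∈ Ioo (0 : ℝ) 1) :
    Continuous fun x => gaussCdfInv (F x) :=
  continuous_iff_continuousAt.2 fun x =>
    ContinuousAt.comp (f := F) (continuousAt_gaussCdfInv (hF x)) hc.continuousAt

/-- Differential form of Gaussian isoperimetry for the superlevel sets, smoothed at scale `ε`,
of `Φ⁻¹ ∘ F`. -/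
lemma gaussProfile_integral_smoothed_le (hc : Continuous F) (hF : ∀ x, F x ∈ Ioo (0 : ℝ) 1)
    (hd : ∀ i x, HasDerivAt (fun u => F (Function.update x i u)) (F' i x) (x i))
    (hc' : ∀ i, Continuous (F' i)) (hk : 0 < k)
    (hgrad : ∀ x, ∑ i, F' i x ^ 2 ≤ (k * gaussProfile (F x)) ^ 2) {ε : ℝ} (hε : 0 < ε) (b : ℝ) :
    gaussProfile (∫ x, gaussCdf ((b + gaussCdfInv (F x)) / ε) ∂(stdGaussian n)) ≤
      √(ε ^ 2 + k ^ 2) *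
        ∫ x, gaussPhi ((b + gaussCdfInv (F x)) / ε) * ε⁻¹ ∂(stdGaussian n) := by
  have hψ := continuous_gaussCdfInv_comp hc hF
  have hI := hc.gaussProfile_comp hF
  have hΦ := continuous_gaussCdf
  have hφ := continuous_gaussPhi
  have hI0 (x) := gaussProfile_pos (F x)
  have hF'k (i : Fin n) (x : Fin n → ℝ) : |F' i x| ≤ k * gaussProfile (F x) := by
    refine abs_le_of_sq_le_sq ?_ (mul_pos hk (hI0 x)).le
    exact (Finset.single_le_sum (f := fun i => F' i x ^ 2) (fun i _ => sq_nonneg _)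
      (Finset.mem_univ i)).trans (hgrad x)
  set g' : Fin n → (Fin n → ℝ) → ℝ := fun i x => gaussPhi ((b + gaussCdfInv (F x)) / ε) *
    ((gaussProfile (F x))⁻¹ * F' i x / ε) with hg'
  have h1 := bobkov_stdGaussian (f := fun x => gaussCdf ((b + gaussCdfInv (F x)) / ε)) (f' := g')
    (C := k / ε) (by fun_prop) (fun x => gaussCdf_mem_Ioo _) (fun i x => ?_) (fun i => ?_)
    (fun i x => ?_)
  · rw [← integral_const_mul]
    refine h1.trans (integral_mono_of_nonneg (Eventually.of_forall fun x => Real.sqrt_nonneg _) ?_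
      (Eventually.of_forall fun x => ?_))
    · refine (integrable_of_continuous_of_abs_le (C := ε⁻¹) (by fun_prop) fun x => ?_).const_mul _
      rw [abs_of_pos (mul_pos (gaussPhi_pos _) (by positivity))]
      exact mul_le_of_le_one_left (by positivity) (gaussPhi_le_one _)
    · simp only [gaussProfile_gaussCdf, hg', mul_pow, ← Finset.mul_sum, div_pow, ← Finset.sum_div]
      set p := gaussPhi ((b + gaussCdfInv (F x)) / ε) with hp
      have hp0 : 0 < p := gaussPhi_pos _
      rw [Real.sqrt_le_left (by positivity), mul_pow, Real.sq_sqrt (by positivity)]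
      have h2 : ((gaussProfile (F x))⁻¹) ^ 2 * ∑ i, F' i x ^ 2 ≤ k ^ 2 := by
        rw [inv_pow, inv_mul_le_iff₀ (by have := hI0 x; positivity), ← mul_pow, mul_comm]
        exact hgrad x
      calc _ = p ^ 2 * (ε ^ 2 + ((gaussProfile (F x))⁻¹) ^ 2 * ∑ i, F' i x ^ 2) / ε ^ 2 := by
            field_simp
        _ ≤ p ^ 2 * (ε ^ 2 + k ^ 2) / ε ^ 2 := by gcongr
        _ = _ := by field_simp
  · have hx : F (Function.update x i (x i)) = F x := by rw [Function.update_eq_self]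
    have h2 := HasDerivAt.comp (x i) (h₂ := gaussCdfInv)
      (h := fun u => F (Function.update x i u)) (by
        rw [hx]; exact hasDerivAt_gaussCdfInv (hF x)) (hd i x)
    have h3 := (h2.const_add b).div_const ε
    have h4 := HasDerivAt.comp (x i) (h₂ := gaussCdf)
      (h := fun u => (b + (gaussCdfInv ∘ fun u => F (Function.update x i u)) u) / ε)
      (hasDerivAt_gaussCdf _) h3
    simp only [Function.comp, hx] at h4
    exact h4
  · have := hc' i
    have h5 : Continuous fun x => (gaussProfile (F x))⁻¹ := hI.inv₀ fun x => (hI0 x).ne'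
    fun_prop
  · have h2 : |(gaussProfile (F x))⁻¹ * F' i x / ε| ≤ k / ε := by
      rw [abs_div, abs_mul, abs_of_pos hε, abs_of_pos (inv_pos.2 (hI0 x))]
      gcongr
      rw [inv_mul_le_iff₀ (hI0 x), mul_comm]
      exact hF'k i x
    rw [hg']
    simp only
    rw [abs_mul, abs_of_pos (gaussPhi_pos _)]
    exact (mul_le_of_le_one_left (abs_nonneg _) (gaussPhi_le_one _)).trans h2

/-- The quantiles of the smoothed superlevel sets grow at least linearly. -/
lemma gaussCdfInv_integral_smoothed_sub_le (hc : Continuous F) (hF : ∀ x, F x ∈ Ioo (0 : ℝ) 1)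
    (hd : ∀ i x, HasDerivAt (fun u => F (Function.update x i u)) (F' i x) (x i))
    (hc' : ∀ i, Continuous (F' i)) (hk : 0 < k)
    (hgrad : ∀ x, ∑ i, F' i x ^ 2 ≤ (k * gaussProfile (F x)) ^ 2) {ε : ℝ} (hε : 0 < ε) {a b : ℝ}
    (hab : a ≤ b) :
    gaussCdfInv (∫ x, gaussCdf ((a + gaussCdfInv (F x)) / ε) ∂(stdGaussian n)) ≤
      gaussCdfInv (∫ x, gaussCdf ((b + gaussCdfInv (F x)) / ε) ∂(stdGaussian n)) -
        (b - a) / √(ε ^ 2 + k ^ 2) := by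
  have hψ := continuous_gaussCdfInv_comp hc hF
  have hΦ := continuous_gaussCdf
  have hφ := continuous_gaussPhi
  have hK : 0 < √(ε ^ 2 + k ^ 2) := by positivity
  set H : ℝ → ℝ := fun b => ∫ x, gaussCdf ((b + gaussCdfInv (F x)) / ε) ∂(stdGaussian n) with hH
  set H' : ℝ → ℝ := fun b =>
    ∫ x, gaussPhi ((b + gaussCdfInv (F x)) / ε) * ε⁻¹ ∂(stdGaussian n) with hH'
  have hH01 (b : ℝ) : H b ∈ Ioo (0 : ℝ) 1 :=
    integral_mem_Ioo_of_continuous (by fun_prop) fun x => gaussCdf_mem_Ioo _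
  have hHd (b : ℝ) : HasDerivAt H (H' b) b := by
    refine (hasDerivAt_integral_of_dominated_loc_of_deriv_le (bound := fun _ => ε⁻¹)
      (F' := fun b x => gaussPhi ((b + gaussCdfInv (F x)) / ε) * ε⁻¹) (s := univ) univ_mem
      (Eventually.of_forall fun b => (Continuous.measurable (by fun_prop)).aestronglyMeasurable)
      (integrable_of_continuous_of_abs_le (C := 1) (by fun_prop) fun x => ?_)
      (Continuous.measurable (by fun_prop)).aestronglyMeasurable
      (Eventually.of_forall fun x b _ => ?_) (integrable_const _)
      (Eventually.of_forall fun x b _ => ?_)).2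
    · rw [abs_of_pos (gaussCdf_mem_Ioo _).1]; exact (gaussCdf_mem_Ioo _).2.le
    · rw [Real.norm_eq_abs, abs_of_pos (mul_pos (gaussPhi_pos _) (by positivity))]
      exact mul_le_of_le_one_left (by positivity) (gaussPhi_le_one _)
    · have h1 := ((hasDerivAt_id b).add_const (gaussCdfInv (F x))).div_const ε
      have h2 := HasDerivAt.comp b (h₂ := gaussCdf) (hasDerivAt_gaussCdf _) h1
      simpa [Function.comp_def] using h2
  have hq (b : ℝ) : HasDerivAt (fun b => gaussCdfInv (H b) - b / √(ε ^ 2 + k ^ 2))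
      ((gaussProfile (H b))⁻¹ * H' b - 1 / √(ε ^ 2 + k ^ 2)) b :=
    (HasDerivAt.comp b (hasDerivAt_gaussCdfInv (hH01 b)) (hHd b)).sub
      ((hasDerivAt_id b).div_const _)
  have hmono : Monotone fun b => gaussCdfInv (H b) - b / √(ε ^ 2 + k ^ 2) := by
    refine monotone_of_hasDerivAt_nonneg hq fun b => ?_
    have h1 := gaussProfile_integral_smoothed_le hc hF hd hc' hk hgrad hε b
    have h2 := gaussProfile_pos (H b)
    change 0 ≤ (gaussProfile (H b))⁻¹ * H' b - 1 / √(ε ^ 2 + k ^ 2)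
    rw [sub_nonneg, div_le_iff₀ hK, mul_assoc, ← div_eq_inv_mul, one_le_div h2, mul_comm]
    exact h1
  have := hmono hab
  simp only at this
  rw [sub_div]
  linarith

/-- Gaussian concentration above the median for `Φ⁻¹ ∘ F`, which is `k`-Lipschitz. -/
lemma measure_gaussCdf_le_of_median (hc : Continuous F) (hF : ∀ x, F x ∈ Ioo (0 : ℝ) 1)
    (hd : ∀ i x, HasDerivAt (fun u => F (Function.update x i u)) (F' i x) (x i))
    (hc' : ∀ i, Continuous (F' i)) (hk : 0 < k)
    (hgrad : ∀ x, ∑ i, F' i x ^ 2 ≤ (k * gaussProfile (F x)) ^ 2) {m r : ℝ} (hr : 0 < r)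
    (hmed : 1 / 2 ≤ (stdGaussian n).real {x | F x ≤ gaussCdf (-m)}) :
    (stdGaussian n).real {x | gaussCdf (-m + r) ≤ F x} ≤ gaussCdf (-r / k) := by
  have hψ := continuous_gaussCdfInv_comp hc hF
  have hΦ := continuous_gaussCdf
  have hInt (b ε : ℝ) : Integrable (fun x => gaussCdf ((b + gaussCdfInv (F x)) / ε))
      (stdGaussian n) :=
    integrable_of_continuous_of_abs_le (C := 1) (by fun_prop) fun x => by
      rw [abs_of_pos (gaussCdf_mem_Ioo _).1]; exact (gaussCdf_mem_Ioo _).2.le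
  have hH01 (b ε : ℝ) : ∫ x, gaussCdf ((b + gaussCdfInv (F x)) / ε) ∂(stdGaussian n) ∈
      Ioo (0 : ℝ) 1 :=
    integral_mem_Ioo_of_continuous (by fun_prop) fun x => gaussCdf_mem_Ioo _
  have key (τ : ℝ) (hτ : 0 < τ) (hτr : 2 * τ ≤ r) :
      gaussCdf τ⁻¹ * (stdGaussian n).real {x | gaussCdf (-m + r) ≤ F x} ≤
        gaussCdf (gaussCdfInv (1 - gaussCdf τ⁻¹ / 2) - (r - 2 * τ) / √((τ ^ 2) ^ 2 + k ^ 2)) := by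
    have hΦτ := gaussCdf_mem_Ioo τ⁻¹
    have h1 := gaussCdfInv_integral_smoothed_sub_le hc hF hd hc' hk hgrad
      (show 0 < τ ^ 2 by positivity) (show m - r + τ ≤ m - τ by linarith)
    have h2 : gaussCdf τ⁻¹ * (stdGaussian n).real {x | gaussCdf (-m + r) ≤ F x} ≤
        ∫ x, gaussCdf ((m - r + τ + gaussCdfInv (F x)) / τ ^ 2) ∂(stdGaussian n) := by
      have hA : MeasurableSet {x | gaussCdf (-m + r) ≤ F x} :=
        measurableSet_le measurable_const hc.measurable
      rw [mul_comm, ← smul_eq_mul, ← integral_indicator_const _ hA]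
      refine integral_mono ((integrable_const _).indicator hA) (hInt _ _) fun x => ?_
      by_cases hx : x ∈ {x | gaussCdf (-m + r) ≤ F x}
      · simp only [indicator_of_mem hx]
        refine strictMono_gaussCdf.monotone ?_
        have h3 : -m + r ≤ gaussCdfInv (F x) := by
          rw [← strictMono_gaussCdf.le_iff_le, gaussCdf_gaussCdfInv (hF x)]
          exact hx
        rw [le_div_iff₀ (by positivity), pow_two, inv_mul_cancel_left₀ hτ.ne']
        linarith
      · simp only [indicator_of_notMem hx]
        exact (gaussCdf_mem_Ioo _).1.le
    have h3 : ∫ x, gaussCdf ((m - τ + gaussCdfInv (F x)) / τ ^ 2) ∂(stdGaussian n) ≤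
        1 - gaussCdf τ⁻¹ / 2 := by
      have hB : MeasurableSet {x | F x ≤ gaussCdf (-m)} :=
        measurableSet_le hc.measurable measurable_const
      have h4 : ∫ x, gaussCdf ((m - τ + gaussCdfInv (F x)) / τ ^ 2) ∂(stdGaussian n) ≤
          ∫ x, (1 - ({x | F x ≤ gaussCdf (-m)}).indicator (fun _ => gaussCdf τ⁻¹) x)
            ∂(stdGaussian n) := by
        refine integral_mono (hInt _ _)
          ((integrable_const _).sub ((integrable_const _).indicator hB)) fun x => ?_
        by_cases hx : x ∈ {x | F x ≤ gaussCdf (-m)}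
        · simp only [indicator_of_mem hx]
          rw [← gaussCdf_neg]
          refine strictMono_gaussCdf.monotone ?_
          have h5 : gaussCdfInv (F x) ≤ -m := by
            rw [← strictMono_gaussCdf.le_iff_le, gaussCdf_gaussCdfInv (hF x)]
            exact hx
          rw [div_le_iff₀ (by positivity), pow_two, neg_mul, inv_mul_cancel_left₀ hτ.ne']
          linarith
        · simp only [indicator_of_notMem hx, sub_zero]
          exact (gaussCdf_mem_Ioo _).2.le
      rw [integral_sub (integrable_const _) ((integrable_const _).indicator hB),
        integral_indicator_const _ hB] at h4
      simp only [integral_const, probReal_univ, smul_eq_mul, one_mul] at h4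
      nlinarith [mul_le_mul_of_nonneg_right hmed hΦτ.1.le]
    refine h2.trans ?_
    rw [← gaussCdf_gaussCdfInv (hH01 (m - r + τ) (τ ^ 2))]
    refine strictMono_gaussCdf.monotone (h1.trans ?_)
    have h6 := strictMonoOn_gaussCdfInv.monotoneOn (hH01 (m - τ) (τ ^ 2))
      (show 1 - gaussCdf τ⁻¹ / 2 ∈ Ioo (0 : ℝ) 1 from
        ⟨by linarith [hΦτ.2], by linarith [hΦτ.1]⟩) h3
    rw [show m - τ - (m - r + τ) = r - 2 * τ by ring]
    linarith
  have hlim1 : Tendsto (fun τ : ℝ => gaussCdf τ⁻¹) (𝓝[>] 0) (𝓝 1) :=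
    tendsto_gaussCdf_atTop.comp tendsto_inv_nhdsGT_zero
  have hlim2 : Tendsto (fun τ : ℝ => gaussCdfInv (1 - gaussCdf τ⁻¹ / 2)) (𝓝[>] 0)
      (𝓝 (gaussCdfInv (1 - 1 / 2))) :=
    (continuousAt_gaussCdfInv (a := 1 - 1 / 2) ⟨by norm_num, by norm_num⟩).tendsto.comp
      ((hlim1.div_const 2).const_sub 1)
  have hlim3 : Tendsto (fun τ : ℝ => (r - 2 * τ) / √((τ ^ 2) ^ 2 + k ^ 2)) (𝓝[>] 0)
      (𝓝 ((r - 2 * 0) / √(((0 : ℝ) ^ 2) ^ 2 + k ^ 2))) := by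
    have : Continuous fun τ : ℝ => (r - 2 * τ) / √((τ ^ 2) ^ 2 + k ^ 2) :=
      Continuous.div (by fun_prop) (by fun_prop) fun τ => by positivity
    exact (this.tendsto 0).mono_left nhdsWithin_le_nhds
  have hlim4 := (hΦ.tendsto _).comp (hlim2.sub hlim3)
  have hv : gaussCdfInv (1 - 1 / 2) - (r - 2 * 0) / √(((0 : ℝ) ^ 2) ^ 2 + k ^ 2) = -r / k := by
    rw [show (1 : ℝ) - 1 / 2 = gaussCdf 0 by rw [gaussCdf_zero]; norm_num, gaussCdfInv_gaussCdf,
      show ((0 : ℝ) ^ 2) ^ 2 + k ^ 2 = k ^ 2 by ring, Real.sqrt_sq hk.le]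
    ring
  rw [hv] at hlim4
  have hlim5 := hlim1.mul_const ((stdGaussian n).real {x | gaussCdf (-m + r) ≤ F x})
  rw [one_mul] at hlim5
  refine le_of_tendsto_of_tendsto hlim5 hlim4 ?_
  filter_upwards [Ioo_mem_nhdsGT (show 0 < r / 2 by linarith)] with τ hτ
  exact key τ hτ.1 (by linarith [hτ.2])

end Concentration

section Median

lemma hasDerivAt_gaussCdf_neg (x : ℝ) :
    HasDerivAt (fun x => gaussCdf (-x)) (-gaussPhi x) x := by
  simpa [gaussPhi_neg, Function.comp_def] using
    (hasDerivAt_gaussCdf (-x)).comp x (hasDerivAt_neg x)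

/-- The Mills ratio bound. -/
lemma gaussPhi_mul_div_le_gaussCdf_neg (x : ℝ) :
    gaussPhi x * (x / (1 + x ^ 2)) ≤ gaussCdf (-x) := by
  have hpos (y : ℝ) : 0 < 1 + y ^ 2 := by positivity
  have hder (y : ℝ) : HasDerivAt (fun y => gaussCdf (-y) - gaussPhi y * (y / (1 + y ^ 2)))
      (-(2 * gaussPhi y / (1 + y ^ 2) ^ 2)) y := by
    have h2 : HasDerivAt (fun y : ℝ => 1 + y ^ 2) (2 * y) y := by
      simpa using (hasDerivAt_pow 2 y).const_add 1
    have h3 := (hasDerivAt_gaussCdf_neg y).sub ((hasDerivAt_gaussPhi y).mul ((hasDerivAt_id y).div h2 (hpos y).ne'))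
    refine h3.congr_deriv ?_
    have := (hpos y).ne'
    simp only [id, Pi.div_apply]
    field_simp
    ring
  have hanti : Antitone fun y => gaussCdf (-y) - gaussPhi y * (y / (1 + y ^ 2)) :=
    antitone_of_hasDerivAt_nonpos hder fun y => by
      have := gaussPhi_pos y
      have := hpos y
      exact neg_nonpos.2 (by positivity)
  have hlim : Tendsto (fun y => gaussCdf (-y) - gaussPhi y * (y / (1 + y ^ 2))) atTop (𝓝 0) := by
    have h1 : Tendsto (fun y => gaussCdf (-y)) atTop (𝓝 0) :=
      tendsto_gaussCdf_atBot.comp tendsto_neg_atTop_atBot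
    have h2 : Tendsto (fun y => gaussPhi y * (y / (1 + y ^ 2))) atTop (𝓝 0) := by
      refine squeeze_zero_norm (fun y => ?_) tendsto_gaussPhi_atTop
      rw [norm_mul, Real.norm_of_nonneg (gaussPhi_pos y).le]
      refine mul_le_of_le_one_right (gaussPhi_pos y).le ?_
      rw [Real.norm_eq_abs, abs_div, abs_of_pos (hpos y), div_le_one (hpos y)]
      nlinarith [sq_nonneg (|y| - 1), sq_abs y, sq_nonneg y]
    simpa using h1.sub h2
  linarith [hanti.le_of_tendsto hlim x]

lemma gaussCdf_neg_mul_le_rpow {θ m : ℝ} (hθ : 0 < θ) (hθ1 : θ ≤ 1) (hm : 0 < m) :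
    gaussCdf (-(θ * m)) ≤ gaussCdf (-m) ^ (θ ^ 2) := by
  have hpos (y : ℝ) : 0 < gaussCdf (-y) := (gaussCdf_mem_Ioo _).1
  have hlog (y : ℝ) : HasDerivAt (fun y => Real.log (gaussCdf (-y)))
      (-gaussPhi y / gaussCdf (-y)) y := (hasDerivAt_gaussCdf_neg y).log (hpos y).ne'
  have hquot (y : ℝ) : HasDerivAt
      (fun y => -(2 * Real.log (gaussCdf (-y))) - y * (gaussPhi y / gaussCdf (-y)))
      (gaussPhi y / gaussCdf (-y) * (1 + y ^ 2 - y * (gaussPhi y / gaussCdf (-y)))) y := by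
    have h := ((hlog y).const_mul 2).neg.sub
      ((hasDerivAt_id y).mul ((hasDerivAt_gaussPhi y).div (hasDerivAt_gaussCdf_neg y) (hpos y).ne'))
    refine h.congr_deriv ?_
    have := (hpos y).ne'
    simp only [id, Pi.div_apply]
    field_simp
    ring
  have hmono : Monotone
      fun y => -(2 * Real.log (gaussCdf (-y))) - y * (gaussPhi y / gaussCdf (-y)) :=
    monotone_of_hasDerivAt_nonneg hquot fun y => by
      have h1 := gaussPhi_mul_div_le_gaussCdf_neg y
      have h2 := hpos y
      refine mul_nonneg (div_nonneg (gaussPhi_pos y).le h2.le) ?_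
      have h3 : (0 : ℝ) < 1 + y ^ 2 := by positivity
      rw [← mul_div_assoc, div_le_iff₀ h3] at h1
      rw [sub_nonneg, ← mul_div_assoc, div_le_iff₀ h2]
      linarith
  have hnonneg (y : ℝ) (hy : 0 ≤ y) :
      0 ≤ -(2 * Real.log (gaussCdf (-y))) - y * (gaussPhi y / gaussCdf (-y)) := by
    refine le_trans ?_ (hmono hy)
    simp only [neg_zero, zero_mul, sub_zero]
    linarith [Real.log_neg (gaussCdf_mem_Ioo 0).1 (gaussCdf_mem_Ioo 0).2]
  have hratio : MonotoneOn (fun y => Real.log (gaussCdf (-y)) / y ^ 2) (Ioi 0) := by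
    have hd (y : ℝ) (hy : 0 < y) : HasDerivAt (fun y => Real.log (gaussCdf (-y)) / y ^ 2)
        ((-(2 * Real.log (gaussCdf (-y))) - y * (gaussPhi y / gaussCdf (-y))) / y ^ 3) y := by
      refine ((hlog y).div (hasDerivAt_pow 2 y) (by positivity)).congr_deriv ?_
      have := (hpos y).ne'
      field_simp
      push_cast
      ring
    refine monotoneOn_of_deriv_nonneg (convex_Ioi 0)
      (fun y hy => (hd y hy).continuousAt.continuousWithinAt)
      (fun y hy => ?_) fun y hy => ?_ <;> rw [interior_Ioi] at hy
    · exact (hd y hy).differentiableAt.differentiableWithinAt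
    · rw [(hd y hy).deriv]
      exact div_nonneg (hnonneg y (le_of_lt hy)) (pow_nonneg (le_of_lt hy) 3)
  have h := hratio (show θ * m ∈ Ioi 0 from mul_pos hθ hm) hm (mul_le_of_le_one_left hm.le hθ1)
  simp only at h
  rw [← Real.log_le_log_iff (hpos _) (Real.rpow_pos_of_pos (hpos m) _),
    Real.log_rpow (hpos m)]
  rw [div_le_div_iff₀ (by positivity) (by positivity)] at h
  have hm2 : 0 < m ^ 2 := by positivity
  nlinarith

lemma integral_le_add_measureReal_le {α : Type*} [MeasurableSpace α] {μ : Measure α}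
    [IsProbabilityMeasure μ] {g : α → ℝ} (hg : Measurable g) (hi : Integrable g μ)
    (h1 : ∀ x, g x ≤ 1) {a : ℝ} (ha : 0 ≤ a) : ∫ x, g x ∂μ ≤ a + μ.real {x | a ≤ g x} := by
  have hA : MeasurableSet {x | a ≤ g x} := measurableSet_le measurable_const hg
  have hind : Integrable ({x | a ≤ g x}.indicator fun _ => (1 : ℝ)) μ :=
    (integrable_const _).indicator hA
  calc ∫ x, g x ∂μ ≤ ∫ x, (a + {x | a ≤ g x}.indicator (fun _ => (1 : ℝ)) x) ∂μ := by
        refine integral_mono hi ((integrable_const a).add hind) fun x => ?_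
        by_cases hx : x ∈ {x | a ≤ g x}
        · simp only [indicator_of_mem hx]
          linarith [h1 x]
        · simp only [indicator_of_notMem hx, add_zero]
          exact (not_le.1 hx).le
    _ = a + μ.real {x | a ≤ g x} := by
        rw [integral_add (integrable_const _) hind, integral_indicator_const _ hA]
        simp

variable {n : ℕ} {f : (Fin n → ℝ) → ℝ} {t M : ℝ}

lemma integral_OU_le_of_mem_Icc (ht : 0 < t) (hm : Measurable f) {η : ℝ} (hη : 0 < η)
    (hf : ∀ x, f x ∈ Icc η (1 - η)) (hM : IsMedian (stdGaussian n) (OU n t f) M) :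
    ∫ x, OU n t f x ∂(stdGaussian n) ≤
      2 * M ^ ((1 / (1 + Real.exp (-t) / √(1 - Real.exp (-2 * t)))) ^ 2) := by
  obtain ⟨hc, hF, F', hd, hc', hgrad⟩ := exists_partialDeriv_OU ht hm hη hf
  have hk : 0 < Real.exp (-t) / √(1 - Real.exp (-2 * t)) :=
    div_pos (Real.exp_pos _) (sqrt_one_sub_exp_pos ht)
  generalize Real.exp (-t) / √(1 - Real.exp (-2 * t)) = k at hk hgrad
  have hF01 (x : Fin n → ℝ) : OU n t f x ∈ Ioo (0 : ℝ) 1 :=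
    ⟨hη.trans_le (hF x).1, (hF x).2.trans_lt (by linarith)⟩
  have hInt : Integrable (OU n t f) (stdGaussian n) :=
    integrable_of_continuous_of_abs_le (C := 1) hc fun x => by
      rw [abs_of_pos (hF01 x).1]; exact (hF01 x).2.le
  have hθ : 0 < 1 / (1 + k) := by positivity
  have hθ1 : 1 / (1 + k) ≤ 1 := by
    rw [div_le_one (by positivity)]; linarith
  have hM0 : 0 < M := by
    obtain ⟨x, hx⟩ : {x | OU n t f x ≤ M}.Nonempty :=
      nonempty_of_measure_ne_zero (μ := stdGaussian n) fun h => by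
        have := hM.1
        rw [h] at this
        norm_num at this
    exact (hF01 x).1.trans_le hx
  rcases le_or_gt (1 / 2) M with hM2 | hM2
  · have hM1 : M < 1 := by
      obtain ⟨x, hx⟩ : {x | M ≤ OU n t f x}.Nonempty :=
        nonempty_of_measure_ne_zero (μ := stdGaussian n) fun h => by
          have := hM.2
          rw [h] at this
          norm_num at this
      exact lt_of_le_of_lt hx (hF01 x).2
    have h1 : M ≤ M ^ ((1 / (1 + k)) ^ 2) := by
      conv_lhs => rw [← Real.rpow_one M]
      exact Real.rpow_le_rpow_of_exponent_ge hM0 hM1.le (pow_le_one₀ hθ.le hθ1)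
    have h2 : ∫ x, OU n t f x ∂(stdGaussian n) ≤ ∫ _, (1 : ℝ) ∂(stdGaussian n) :=
      integral_mono hInt (integrable_const _) fun x => (hF01 x).2.le
    simp only [integral_const, probReal_univ, smul_eq_mul, one_mul] at h2
    linarith
  · have hMm : M ∈ Ioo (0 : ℝ) 1 := ⟨hM0, by linarith⟩
    obtain ⟨m, hmM⟩ : ∃ m, gaussCdf (-m) = M :=
      ⟨-gaussCdfInv M, by rw [neg_neg, gaussCdf_gaussCdfInv hMm]⟩
    have hm0 : 0 < m := by
      rw [← neg_lt_zero, ← strictMono_gaussCdf.lt_iff_lt, hmM, gaussCdf_zero]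
      linarith
    have hr : 0 < m * k / (1 + k) := by positivity
    have hmed : 1 / 2 ≤ (stdGaussian n).real {x | OU n t f x ≤ gaussCdf (-m)} := by
      rw [hmM]
      have := ENNReal.toReal_mono (measure_ne_top _ _) hM.1
      simpa [Measure.real] using this
    have h1 := measure_gaussCdf_le_of_median hc hF01 hd hc' hk hgrad hr hmed
    have h2 := integral_le_add_measureReal_le hc.measurable hInt (fun x => (hF01 x).2.le)
      (gaussCdf_mem_Ioo (-m + m * k / (1 + k))).1.le
    have h3 := gaussCdf_neg_mul_le_rpow hθ hθ1 hm0
    rw [show -(m * k / (1 + k)) / k = -(1 / (1 + k) * m) by field_simp] at h1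
    rw [show -m + m * k / (1 + k) = -(1 / (1 + k) * m) by field_simp; ring] at h1 h2
    rw [hmM] at h3
    linarith

lemma integrable_of_measurable_of_mem_Icc (hm : Measurable f) (hf : ∀ x, f x ∈ Icc (0 : ℝ) 1) :
    Integrable f (stdGaussian n) :=
  Integrable.of_bound hm.aestronglyMeasurable 1 (ae_of_all _ fun x => by
    rw [Real.norm_of_nonneg (hf x).1]; exact (hf x).2)

lemma OU_affine (hm : Measurable f) (hf : ∀ x, f x ∈ Icc (0 : ℝ) 1) (a b : ℝ) :
    OU n t (fun x => a * f x + b) = fun x => a * OU n t f x + b := by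
  funext x
  have hi := integrable_of_measurable_of_mem_Icc (n := n)
    (f := fun y => f fun i => Real.exp (-t) * x i + √(1 - Real.exp (-2 * t)) * y i)
    (hm.comp (by fun_prop)) fun y => hf _
  simp only [OU]
  rw [integral_add (hi.const_mul a) (integrable_const b), integral_const_mul]
  simp

lemma integral_OU_le_of_isMedian (ht : 0 < t) (hm : Measurable f)
    (hf : ∀ x, f x ∈ Icc (0 : ℝ) 1) (hM : IsMedian (stdGaussian n) (OU n t f) M) :
    ∫ x, OU n t f x ∂(stdGaussian n) ≤
      2 * M ^ ((1 / (1 + Real.exp (-t) / √(1 - Real.exp (-2 * t)))) ^ 2) := by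
  have hk : 0 < Real.exp (-t) / √(1 - Real.exp (-2 * t)) :=
    div_pos (Real.exp_pos _) (sqrt_one_sub_exp_pos ht)
  have hp : 0 < (1 / (1 + Real.exp (-t) / √(1 - Real.exp (-2 * t)))) ^ 2 := by positivity
  have key (η : ℝ) (hη : 0 < η) (hη2 : η < 1 / 2) :
      (1 - 2 * η) * ∫ x, OU n t f x ∂(stdGaussian n) ≤ 2 * ((1 - 2 * η) * M + η) ^
        ((1 / (1 + Real.exp (-t) / √(1 - Real.exp (-2 * t)))) ^ 2) := by
    have ha : 0 < 1 - 2 * η := by linarith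
    have hmem (x : Fin n → ℝ) : (1 - 2 * η) * f x + η ∈ Icc η (1 - η) :=
      ⟨by nlinarith [(hf x).1], by nlinarith [(hf x).2]⟩
    have hmed : IsMedian (stdGaussian n) (OU n t fun x => (1 - 2 * η) * f x + η)
        ((1 - 2 * η) * M + η) := by
      rw [OU_affine hm hf]
      simpa only [IsMedian, add_le_add_iff_right, mul_le_mul_iff_right₀ ha] using hM
    have h := integral_OU_le_of_mem_Icc ht (by fun_prop) hη hmem hmed
    have hInt : Integrable (fun x => (1 - 2 * η) * OU n t f x + η) (stdGaussian n) := by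
      obtain ⟨hc, hF, -⟩ := exists_partialDeriv_OU (n := n) ht (by fun_prop) hη hmem
      rw [← OU_affine hm hf]
      refine integrable_of_continuous_of_abs_le (C := 1) hc fun x => ?_
      rw [abs_of_nonneg (hη.le.trans (hF x).1)]
      linarith [(hF x).2]
    rw [OU_affine hm hf] at h
    refine le_trans ?_ h
    rw [← integral_const_mul]
    refine integral_mono ?_ hInt fun x => by simp only; linarith
    simpa [Pi.sub_def] using hInt.sub (integrable_const η)
  have hl : Tendsto (fun η : ℝ => (1 - 2 * η) * ∫ x, OU n t f x ∂(stdGaussian n)) (𝓝[>] 0)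
      (𝓝 ((1 - 2 * 0) * ∫ x, OU n t f x ∂(stdGaussian n))) :=
    ((by fun_prop : Continuous fun η : ℝ => (1 - 2 * η) * ∫ x, OU n t f x ∂(stdGaussian n)).tendsto
      0).mono_left nhdsWithin_le_nhds
  have hr : Tendsto (fun η : ℝ => 2 * ((1 - 2 * η) * M + η) ^
        ((1 / (1 + Real.exp (-t) / √(1 - Real.exp (-2 * t)))) ^ 2)) (𝓝[>] 0)
      (𝓝 (2 * ((1 - 2 * 0) * M + 0) ^
        ((1 / (1 + Real.exp (-t) / √(1 - Real.exp (-2 * t)))) ^ 2))) := by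
    refine Tendsto.mono_left (Continuous.tendsto ?_ 0) nhdsWithin_le_nhds
    exact continuous_const.mul
      ((by fun_prop : Continuous fun η : ℝ => (1 - 2 * η) * M + η).rpow_const
        fun _ => Or.inr hp.le)
  have := le_of_tendsto_of_tendsto hl hr (by
    filter_upwards [Ioo_mem_nhdsGT (show (0 : ℝ) < 1 / 2 by norm_num)] with η hη
    exact key η hη.1 hη.2)
  simpa only [mul_zero, sub_zero, one_mul, add_zero] using this

end Median

end

/-- median versus mean for `f_t = P_t f`. -/
theorem stmt7 (n : ℕ) (f : (Fin n → ℝ) → ℝ) (hmeas : Measurable f)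
    (hf : ∀ x, f x ∈ Set.Icc (0 : ℝ) 1) (t : ℝ) (ht : 0 < t) (M : ℝ)
    (hM : IsMedian (stdGaussian n) (OU n t f) M) :
    ∫ x, OU n t f x ∂(stdGaussian n)
      ≤ 2 * M ^ ((1 / (1 + Real.exp (-t) / Real.sqrt (1 - Real.exp (-2 * t)))) ^ 2 : ℝ) := by
  exact integral_OU_le_of_isMedian ht hmeas hf hM
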